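/- Let A = KQ/I be a geometrically irreducible finite-dimensional algebra over an algebraically closed field K, where Q is a finite quiver and I is an admissible ideal of KQ. Then A is an Iwanaga–Gorenstein algebra, i.e. the left A-module A has finite injective dimension and the right A-module A has finite injective dimension (equivalently, proj.dim D(A_A) < ∞ and inj.dim(_A A) < ∞, where D = Hom_K(−,K)). Moreover, for a finite-dimensional A-module M the following are equivalent: (i) M has finite projective dimension; (ii) M has finite injective dimension; (iii) M is locally free. -/

import Mathlib

open scoped BigOperators

noncomputable section
/-! ## Quivers and paths -/

/-- A finite quiver: finite sets of vertices and arrows together with source and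
target maps. -/
structure FinQuiver : Type 1 where
  V : Type
  A : Type
  [fintypeV : Fintype V]
  [fintypeA : Fintype A]
  [decEqV : DecidableEq V]
  [decEqA : DecidableEq A]
  src : A → V
  tgt : A → V

attribute [instance] FinQuiver.fintypeV FinQuiver.fintypeA FinQuiver.decEqV FinQuiver.decEqA

/-- A path of positive length in a quiver: a list of composable arrows `[a₁, …, aₘ]`
satisfying `s (aᵢ) = t (aᵢ₊₁)`. -/
structure QPath (Q : FinQuiver) : Type where
  arrows : List Q.A
  ne : arrows ≠ []
  chain : arrows.Chain' fun a b => Q.src a = Q.tgt b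

namespace QPath

variable {Q : FinQuiver}

/-- The length of a path. -/
def length (p : QPath Q) : ℕ := p.arrows.length

/-- The target `t (a₁)` of a path `(a₁, …, aₘ)`. -/
def tgt (p : QPath Q) : Q.V := Q.tgt (p.arrows.head p.ne)

/-- The source `s (aₘ)` of a path `(a₁, …, aₘ)`. -/
def src (p : QPath Q) : Q.V := Q.src (p.arrows.getLast p.ne)

/-- A path is a cycle if its source equals its target. -/
def IsCycle (p : QPath Q) : Prop := p.src = p.tgt

/-- A cycle `(a₁, …, aₘ)` is primitive if the vertices `s (a₁), …, s (aₘ)` are pairwise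
different. -/
def IsPrimitive (p : QPath Q) : Prop := (p.arrows.map Q.src).Nodup

end QPath

/-! ## The path algebra, relations, admissible ideals and representation varieties -/

/-- The defining relations presenting the path algebra `KQ` as a quotient of the free
algebra on the vertices and arrows of `Q`: the vertices become a complete set of
orthogonal idempotents summing to `1`, and `e_{t(a)} * a = a = a * e_{s(a)}` for every
arrow `a`. -/
inductive PathRel (K : Type) [Field K] (Q : FinQuiver) :
    FreeAlgebra K (Q.V ⊕ Q.A) → FreeAlgebra K (Q.V ⊕ Q.A) → Prop
  | idem (i : Q.V) : PathRel K Q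
      (FreeAlgebra.ι K (Sum.inl i) * FreeAlgebra.ι K (Sum.inl i)) (FreeAlgebra.ι K (Sum.inl i))
  | orth (i j : Q.V) (h : i ≠ j) : PathRel K Q
      (FreeAlgebra.ι K (Sum.inl i) * FreeAlgebra.ι K (Sum.inl j)) 0
  | sum_one : PathRel K Q (∑ i : Q.V, FreeAlgebra.ι K (Sum.inl i)) 1
  | tgt_mul (a : Q.A) : PathRel K Q
      (FreeAlgebra.ι K (Sum.inl (Q.tgt a)) * FreeAlgebra.ι K (Sum.inr a))
      (FreeAlgebra.ι K (Sum.inr a))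
  | mul_src (a : Q.A) : PathRel K Q
      (FreeAlgebra.ι K (Sum.inr a) * FreeAlgebra.ι K (Sum.inl (Q.src a)))
      (FreeAlgebra.ι K (Sum.inr a))

/-- The path algebra `KQ`. -/
abbrev PathAlgebra (K : Type) [Field K] (Q : FinQuiver) : Type := RingQuot (PathRel K Q)

variable (K : Type) [Field K] (Q : FinQuiver)

/-- The idempotent `eᵢ ∈ KQ` corresponding to a vertex `i` (the path of length zero
at `i`). -/
def vertexElem (i : Q.V) : PathAlgebra K Q :=
  RingQuot.mkAlgHom K (PathRel K Q) (FreeAlgebra.ι K (Sum.inl i))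

/-- The element of `KQ` corresponding to an arrow `a`. -/
def arrowElem (a : Q.A) : PathAlgebra K Q :=
  RingQuot.mkAlgHom K (PathRel K Q) (FreeAlgebra.ι K (Sum.inr a))

/-- The element of `KQ` corresponding to a path `(a₁, …, aₘ)`, namely `a₁ ⋯ aₘ`. -/
def pathElem (p : QPath Q) : PathAlgebra K Q := (p.arrows.map (arrowElem K Q)).prod

/-- The element `∑ₚ c p • p` of `KQ` determined by a finitely supported family of
coefficients on paths. -/
def relElem (c : QPath Q →₀ K) : PathAlgebra K Q := c.sum fun p l => l • pathElem K Q p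

/-- `c` is the datum of a relation with common target `i` and common source `j`: all
paths in its support have length at least two, target `i` and source `j`.  (The paths in
the support are pairwise different and have nonzero coefficients by definition of a
finitely supported function.) -/
def IsRelationData (c : QPath Q →₀ K) (i j : Q.V) : Prop :=
  ∀ p ∈ c.support, 2 ≤ p.length ∧ p.tgt = i ∧ p.src = j

/-- An element of `KQ` is a relation if it is a `K`-linear combination `∑ λₚ • p` of
pairwise different paths of length at least two having a common source and a common
target, with all `λₚ ≠ 0`. -/
def IsRelation (x : PathAlgebra K Q) : Prop :=
  ∃ (c : QPath Q →₀ K) (i j : Q.V), IsRelationData K Q c i j ∧ x = relElem K Q c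

/-- The two-sided ideal generated by a set `S`, as a set: the additive subgroup generated
by all elements `a * s * b` with `s ∈ S`. -/
def twoSidedSpan (R : Type) [Ring R] (S : Set R) : Set R :=
  (AddSubgroup.closure {x | ∃ a b : R, ∃ s ∈ S, x = a * s * b} : AddSubgroup R)

/-- `φ : KQ →ₐ[K] A` presents `A` as `KQ/I` with `I = ker φ` an admissible ideal:
`φ` is surjective, its kernel is generated (as a two-sided ideal) by a set of relations,
and there is some `m ≥ 2` such that all paths of length at least `m` lie in the kernel. -/
def IsAdmissiblePresentation {A : Type} [Ring A] [Algebra K A]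
    (φ : PathAlgebra K Q →ₐ[K] A) : Prop :=
  Function.Surjective φ ∧
  (∃ S : Set (PathAlgebra K Q), (∀ x ∈ S, IsRelation K Q x) ∧
    twoSidedSpan (PathAlgebra K Q) S = {x | φ x = 0}) ∧
  ∃ m : ℕ, 2 ≤ m ∧ ∀ p : QPath Q, m ≤ p.length → φ (pathElem K Q p) = 0

/-- The index type for the rows/columns of the matrices in a `d`-dimensional
representation: the basis vectors of `⊕ᵢ K^{dᵢ}`. -/
abbrev RepIx (d : Q.V → ℕ) : Type := (i : Q.V) × Fin (d i)

/-- The ambient affine space of `d`-dimensional representations.  An arrow `a` gets a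
matrix; membership in `RepSet` forces the matrix of `a` to be concentrated in the block
with rows indexed by the block `t(a)` and columns indexed by the block `s(a)`, i.e. to be
(the block extension of) a `d (t a) × d (s a)`-matrix. -/
abbrev RepSpace (d : Q.V → ℕ) : Type := Q.A → Matrix (RepIx Q d) (RepIx Q d) K

/-- The Zariski topology on affine space `K^ι`: generated by the complements of zero sets
of polynomials in the coordinates. -/
def zariskiTopology (ι R : Type) [CommSemiring R] : TopologicalSpace (ι → R) :=
  TopologicalSpace.generateFrom
    {U | ∃ f : MvPolynomial ι R, U = {x | MvPolynomial.eval x f ≠ 0}}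

/-- The Zariski topology on the ambient space of `d`-dimensional representations. -/
def repTopology (d : Q.V → ℕ) : TopologicalSpace (RepSpace K Q d) :=
  TopologicalSpace.induced (fun M (x : Q.A × RepIx Q d × RepIx Q d) => M x.1 x.2.1 x.2.2)
    (zariskiTopology (Q.A × RepIx Q d × RepIx Q d) K)

/-- The condition that the matrix of each arrow `a` is concentrated in the
`(t a, s a)`-block, i.e. really is a `d (t a) × d (s a)`-matrix. -/
def BlockCompatible (d : Q.V → ℕ) (M : RepSpace K Q d) : Prop :=
  ∀ (a : Q.A) (u v : RepIx Q d), M a u v ≠ 0 → u.1 = Q.tgt a ∧ v.1 = Q.src a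

/-- The evaluation `M(p) = M(a₁) ⋯ M(aₘ)` of a representation at a path. -/
def pathProd (d : Q.V → ℕ) (M : RepSpace K Q d) (p : QPath Q) :
    Matrix (RepIx Q d) (RepIx Q d) K := (p.arrows.map M).prod

/-- The evaluation `M(ρ) = ∑ λₚ M(p)` of a representation at a linear combination of
paths. -/
def relEval (d : Q.V → ℕ) (M : RepSpace K Q d) (c : QPath Q →₀ K) :
    Matrix (RepIx Q d) (RepIx Q d) K := c.sum fun p l => l • pathProd K Q d M p

/-- The affine variety `rep(A, d)` of `d`-dimensional representations of `A = KQ/I`,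
where `I = ker φ`: tuples of matrices (of the correct block sizes) with `M(ρ) = 0` for
every relation `ρ ∈ I`. -/
def RepSet {A : Type} [Ring A] [Algebra K A] (φ : PathAlgebra K Q →ₐ[K] A) (d : Q.V → ℕ) :
    Set (RepSpace K Q d) :=
  {M | BlockCompatible K Q d M ∧
    ∀ (c : QPath Q →₀ K) (i j : Q.V), IsRelationData K Q c i j →
      φ (relElem K Q c) = 0 → relEval K Q d M c = 0}

/-- `A = KQ/I` (presented by `φ`, with `I = ker φ`) is geometrically irreducible if
`rep(A, d)` is an irreducible topological space for every dimension vector `d`. -/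
def IsGeomIrreducible {A : Type} [Ring A] [Algebra K A] (φ : PathAlgebra K Q →ₐ[K] A) :
    Prop :=
  ∀ d : Q.V → ℕ, @IsIrreducible _ (repTopology K Q d) (RepSet K Q φ d)

/-! ## Projective and injective dimension -/

/-- `HasProjDimLE A n M` : the `A`-module `M` has projective dimension at most `n`,
i.e. there is a projective resolution `0 → Pₙ → ⋯ → P₀ → M → 0`. -/
def HasProjDimLE (A : Type) [Ring A] : ℕ → ModuleCat.{0} A → Prop
  | 0, M => Module.Projective A M
  | n + 1, M => ∃ (P : ModuleCat.{0} A) (f : P →ₗ[A] M), Module.Projective A P ∧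
      Function.Surjective f ∧ HasProjDimLE A n (ModuleCat.of A ↥(LinearMap.ker f))

/-- `HasInjDimLE A n M` : the `A`-module `M` has injective dimension at most `n`,
i.e. there is an injective coresolution `0 → M → I⁰ → ⋯ → Iⁿ → 0`. -/
def HasInjDimLE (A : Type) [Ring A] : ℕ → ModuleCat.{0} A → Prop
  | 0, M => Module.Injective A M
  | n + 1, M => ∃ (I : ModuleCat.{0} A) (f : M →ₗ[A] I), Module.Injective A I ∧
      Function.Injective f ∧ HasInjDimLE A n (ModuleCat.of A (↥I ⧸ LinearMap.range f))

/-- A ring is hereditary iff its (left) global dimension is at most one, i.e. every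
module has projective dimension at most `1`. -/
def IsHereditaryRing (A : Type) [Ring A] : Prop :=
  ∀ M : ModuleCat.{0} A, HasProjDimLE A 1 M

/-- A ring has finite (left) global dimension if there is a simultaneous bound on the
projective dimensions of all modules. -/
def HasFiniteGlobalDimension (A : Type) [Ring A] : Prop :=
  ∃ n : ℕ, ∀ M : ModuleCat.{0} A, HasProjDimLE A n M

/-! ## Corner rings `eAe` and local freeness -/

/-- An idempotent element of a ring. -/
structure IdemElem (A : Type) [Ring A] : Type where
  e : A
  idem : e * e = e

/-- The corner ring `eAe` of an idempotent `e`. -/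
def Corner {A : Type} [Ring A] (ε : IdemElem A) : Type :=
  {x : A // ε.e * x = x ∧ x * ε.e = x}

namespace Corner

variable {A : Type} [Ring A] {ε : IdemElem A}

instance : Zero (Corner ε) := ⟨⟨0, by simp⟩⟩
instance : Add (Corner ε) :=
  ⟨fun x y => ⟨x.1 + y.1, by rw [mul_add, x.2.1, y.2.1], by rw [add_mul, x.2.2, y.2.2]⟩⟩
instance : Neg (Corner ε) :=
  ⟨fun x => ⟨-x.1, by rw [mul_neg, x.2.1], by rw [neg_mul, x.2.2]⟩⟩
instance : One (Corner ε) := ⟨⟨ε.e, ε.idem, ε.idem⟩⟩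
instance : Mul (Corner ε) :=
  ⟨fun x y => ⟨x.1 * y.1, by rw [← mul_assoc, x.2.1], by rw [mul_assoc, y.2.2]⟩⟩

instance instRing : Ring (Corner ε) where
  add_assoc x y z := Subtype.ext (add_assoc _ _ _)
  zero_add x := Subtype.ext (zero_add _)
  add_zero x := Subtype.ext (add_zero _)
  add_comm x y := Subtype.ext (add_comm _ _)
  neg_add_cancel x := Subtype.ext (neg_add_cancel _)
  mul_assoc x y z := Subtype.ext (mul_assoc _ _ _)
  one_mul x := Subtype.ext x.2.1
  mul_one x := Subtype.ext x.2.2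
  left_distrib x y z := Subtype.ext (left_distrib _ _ _)
  right_distrib x y z := Subtype.ext (right_distrib _ _ _)
  zero_mul x := Subtype.ext (zero_mul _)
  mul_zero x := Subtype.ext (mul_zero _)
  nsmul := nsmulRec
  zsmul := zsmulRec

end Corner

/-- The subgroup `eM` of an `A`-module `M`, as a module over the corner ring `eAe`. -/
def CornerMod {A : Type} [Ring A] (ε : IdemElem A) (M : Type) [AddCommGroup M]
    [Module A M] : Type :=
  {m : M // ε.e • m = m}

namespace CornerMod

variable {A : Type} [Ring A] {ε : IdemElem A} {M : Type} [AddCommGroup M] [Module A M]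

instance : Zero (CornerMod ε M) := ⟨⟨0, smul_zero _⟩⟩
instance : Add (CornerMod ε M) := ⟨fun x y => ⟨x.1 + y.1, by rw [smul_add, x.2, y.2]⟩⟩
instance : Neg (CornerMod ε M) := ⟨fun x => ⟨-x.1, by rw [smul_neg, x.2]⟩⟩

instance instAddCommGroup : AddCommGroup (CornerMod ε M) where
  add_assoc x y z := Subtype.ext (add_assoc _ _ _)
  zero_add x := Subtype.ext (zero_add _)
  add_zero x := Subtype.ext (add_zero _)
  add_comm x y := Subtype.ext (add_comm _ _)
  neg_add_cancel x := Subtype.ext (neg_add_cancel _)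
  nsmul := nsmulRec
  zsmul := zsmulRec

instance instSMul : SMul (Corner ε) (CornerMod ε M) :=
  ⟨fun c m => ⟨c.1 • m.1, by rw [smul_smul, c.2.1]⟩⟩

theorem val_smul (c : Corner ε) (m : CornerMod ε M) : (c • m).1 = c.1 • m.1 := rfl
theorem val_zero : (0 : CornerMod ε M).1 = 0 := rfl
theorem val_add (m n : CornerMod ε M) : (m + n).1 = m.1 + n.1 := rfl

instance instModule : Module (Corner ε) (CornerMod ε M) where
  one_smul m := Subtype.ext (by rw [val_smul]; exact m.2)
  mul_smul c d m := Subtype.ext (by simp only [val_smul]; exact mul_smul c.1 d.1 m.1)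
  smul_zero c := Subtype.ext (by simp only [val_smul, val_zero]; exact smul_zero c.1)
  smul_add c m n := Subtype.ext
    (by simp only [val_smul, val_add]; exact smul_add c.1 m.1 n.1)
  add_smul c d m := Subtype.ext
    (by simp only [val_smul, val_add]; exact add_smul c.1 d.1 m.1)
  zero_smul m := Subtype.ext (by simp only [val_smul, val_zero]; exact zero_smul A m.1)

end CornerMod

theorem vertexElem_mul_self (i : Q.V) :
    vertexElem K Q i * vertexElem K Q i = vertexElem K Q i := by
  rw [vertexElem, ← map_mul]
  exact RingQuot.mkAlgHom_rel K (PathRel.idem i)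

/-- The idempotent `eᵢ ∈ A = KQ/I` corresponding to a vertex `i`. -/
def vertexIdem {A : Type} [Ring A] [Algebra K A] (φ : PathAlgebra K Q →ₐ[K] A)
    (i : Q.V) : IdemElem A :=
  ⟨φ (vertexElem K Q i), by rw [← map_mul, vertexElem_mul_self]⟩

/-- An `A = KQ/I`-module `M` is locally free if `eᵢM` is a free `eᵢAeᵢ`-module for
every vertex `i`. -/
def IsLocallyFree {A : Type} [Ring A] [Algebra K A] (φ : PathAlgebra K Q →ₐ[K] A)
    (M : Type) [AddCommGroup M] [Module A M] : Prop :=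
  ∀ i : Q.V,
    Module.Free (Corner (vertexIdem K Q φ i)) (CornerMod (vertexIdem K Q φ i) M)

section

/-! ## Frobenius corner algebras and Higman's criterion -/

/-- A Frobenius structure on the corner algebra `eAe` of an idempotent `e`: a linear form
together with a pair of dual bases. -/
structure FrobCorner (k : Type) [Field k] {A : Type} [Ring A] [Algebra k A] (e : A) : Type where
  idem : e * e = e
  n : ℕ
  b : Fin n → A
  b' : Fin n → A
  form : A →ₗ[k] k
  left_b : ∀ s, e * b s = b s
  right_b : ∀ s, b s * e = b s
  left_b' : ∀ s, e * b' s = b' s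
  right_b' : ∀ s, b' s * e = b' s
  sum_left : ∀ x, e * x = x → x * e = x → ∑ s, form (b' s * x) • b s = x
  sum_right : ∀ x, e * x = x → x * e = x → ∑ s, form (x * b s) • b' s = x

namespace FrobCorner

variable {k : Type} [Field k] {A : Type} [Ring A] [Algebra k A] {e : A}

open MulOpposite in
/-- The opposite Frobenius structure. -/
def op (F : FrobCorner k e) : FrobCorner k (MulOpposite.op e) where
  idem := by rw [← MulOpposite.op_mul, F.idem]
  n := F.n
  b s := MulOpposite.op (F.b' s)
  b' s := MulOpposite.op (F.b s)
  form := F.form ∘ₗ (MulOpposite.opLinearEquiv k).symm.toLinearMap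
  left_b s := by rw [← MulOpposite.op_mul, F.right_b']
  right_b s := by rw [← MulOpposite.op_mul, F.left_b']
  left_b' s := by rw [← MulOpposite.op_mul, F.right_b]
  right_b' s := by rw [← MulOpposite.op_mul, F.left_b]
  sum_left x h₁ h₂ := by
    apply MulOpposite.unop_injective
    have h₁' : x.unop * e = x.unop := by simpa using congrArg MulOpposite.unop h₁
    have h₂' : e * x.unop = x.unop := by simpa using congrArg MulOpposite.unop h₂
    simpa using F.sum_right x.unop h₂' h₁'
  sum_right x h₁ h₂ := by
    apply MulOpposite.unop_injective
    have h₁' : x.unop * e = x.unop := by simpa using congrArg MulOpposite.unop h₁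
    have h₂' : e * x.unop = x.unop := by simpa using congrArg MulOpposite.unop h₂
    simpa using F.sum_left x.unop h₂' h₁'

variable {M N L : Type} [AddCommGroup M] [Module k M] [Module A M] [IsScalarTower k A M]
  [AddCommGroup N] [Module k N] [Module A N] [IsScalarTower k A N]
  [AddCommGroup L] [Module k L] [Module A L] [IsScalarTower k A L]

variable (F : FrobCorner k e)

/-- The relative trace of a linear map, which is linear over the corner algebra. -/
def tr (θ : M →ₗ[k] N) : M →ₗ[k] N :=
  ∑ s, (Algebra.lsmul k k N (F.b s)) ∘ₗ θ ∘ₗ (Algebra.lsmul k k M (F.b' s))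

theorem tr_apply (θ : M →ₗ[k] N) (x : M) : F.tr θ x = ∑ s, F.b s • θ (F.b' s • x) := by
  simp [tr]

theorem idem_smul_tr (θ : M →ₗ[k] N) (x : M) : e • F.tr θ x = F.tr θ x := by
  simp [tr_apply, Finset.smul_sum, smul_smul, F.left_b]

theorem tr_idem_smul (θ : M →ₗ[k] N) (x : M) : F.tr θ (e • x) = F.tr θ x := by
  simp [tr_apply, smul_smul, F.right_b']

theorem tr_smul (θ : M →ₗ[k] N) {a : A} (h₁ : e * a = a) (h₂ : a * e = a) (x : M) :
    F.tr θ (a • x) = a • F.tr θ x := by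
  have hl : ∀ s, F.b' s * a = ∑ t, F.form (F.b' s * a * F.b t) • F.b' t := fun s =>
    (F.sum_right _ (by rw [← mul_assoc, F.left_b']) (by rw [mul_assoc, h₂])).symm
  have hr : ∀ s, a * F.b s = ∑ t, F.form (F.b' t * a * F.b s) • F.b t := fun s => by
    simpa [mul_assoc] using
      (F.sum_left (a * F.b s) (by rw [← mul_assoc, h₁]) (by rw [mul_assoc, F.right_b])).symm
  simp only [tr_apply, Finset.smul_sum, smul_smul]
  conv_lhs => enter [2, s]; rw [hl, Finset.sum_smul, map_sum, Finset.smul_sum]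
  conv_rhs => enter [2, s]; rw [hr, Finset.sum_smul]
  rw [Finset.sum_comm]
  refine Finset.sum_congr rfl fun s _ => Finset.sum_congr rfl fun t _ => ?_
  rw [smul_assoc, map_smul, smul_algebra_smul_comm, smul_assoc]

theorem map_tr (g : N →ₗ[A] L) (θ : M →ₗ[k] N) (x : M) :
    g (F.tr θ x) = F.tr (g.restrictScalars k ∘ₗ θ) x := by
  simp [tr_apply]

theorem tr_map (g : M →ₗ[A] N) (θ : N →ₗ[k] L) (x : M) :
    F.tr θ (g x) = F.tr (θ ∘ₗ g.restrictScalars k) x := by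
  simp [tr_apply]

/-- Higman's criterion for `eM` being projective (equivalently, injective) over `eAe`. -/
def Higman (M : Type) [AddCommGroup M] [Module k M] [Module A M] [IsScalarTower k A M] : Prop :=
  ∃ θ : M →ₗ[k] M, ∀ x, e • x = x → F.tr θ x = x

/-- The right-handed version of Higman's criterion for the regular bimodule. -/
def RightHigman : Prop :=
  ∃ θ : A →ₗ[k] A, ∀ x, x * e = x → ∑ s, θ (x * F.b s) * F.b' s = x

variable {F}

theorem Higman.of_retract (h : F.Higman N) (i : M →ₗ[A] N) (p : N →ₗ[A] M)
    (hpi : ∀ x, p (i x) = x) : F.Higman M := by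
  obtain ⟨θ, hθ⟩ := h
  refine ⟨p.restrictScalars k ∘ₗ θ ∘ₗ i.restrictScalars k, fun x hx => ?_⟩
  rw [← map_tr, ← tr_map, hθ _ (by rw [← map_smul, hx]), hpi]

theorem Higman.finsupp (h : F.Higman A) (ι : Type) : F.Higman (ι →₀ A) := by
  obtain ⟨θ, hθ⟩ := h
  refine ⟨Finsupp.mapRange.linearMap θ, fun x hx => ?_⟩
  ext i
  have := hθ (x i) (by simpa using DFunLike.congr_fun hx i)
  rw [tr_apply] at this ⊢
  simpa [Finsupp.finsetSum_apply] using this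

theorem Higman.of_projective (h : F.Higman A) (hM : Module.Projective A M) : F.Higman M := by
  obtain ⟨s, hs⟩ := Module.projective_def'.1 hM
  exact (h.finsupp M).of_retract s (Finsupp.linearCombination A id) (fun x => LinearMap.congr_fun hs x)

/-- Higman's criterion passes to cokernels of injective maps. -/
theorem Higman.of_exact_right (f : L →ₗ[A] N) (g : N →ₗ[A] M) (hf : Function.Injective f)
    (hg : Function.Surjective g) (hfg : LinearMap.range f = LinearMap.ker g)
    (hL : F.Higman L) (hN : F.Higman N) : F.Higman M := by
  obtain ⟨θL, hθL⟩ := hL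
  obtain ⟨θN, hθN⟩ := hN
  obtain ⟨r, hr⟩ := (f.restrictScalars k).exists_leftInverse_of_injective
    (LinearMap.ker_eq_bot.2 hf)
  obtain ⟨s₀, hs₀⟩ := (g.restrictScalars k).exists_rightInverse_of_surjective
    (LinearMap.range_eq_top.2 hg)
  replace hr : ∀ x, r (f x) = x := fun x => LinearMap.congr_fun hr x
  replace hs₀ : ∀ x, g (s₀ x) = x := fun x => LinearMap.congr_fun hs₀ x
  have hgf : ∀ x, g (f x) = 0 := fun x => by
    rw [← LinearMap.mem_ker, ← hfg]; exact LinearMap.mem_range_self f x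
  set ρ : N →ₗ[k] L := F.tr (θL ∘ₗ r) with hρ
  have hρf : ∀ x, e • x = x → ρ (f x) = x := fun x hx => by
    rw [hρ, tr_map]
    have : (θL ∘ₗ r) ∘ₗ f.restrictScalars k = θL := LinearMap.ext fun y => by simp [hr]
    rw [this, hθL x hx]
  let s : M →ₗ[k] N := Algebra.lsmul k k N e ∘ₗ s₀ - f.restrictScalars k ∘ₗ ρ ∘ₗ s₀
  have hs_apply : ∀ x, s x = e • s₀ x - f (ρ (s₀ x)) := fun x => rfl
  have hgs : ∀ x, g (s x) = e • x := fun x => by simp [hs_apply, hgf, hs₀]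
  have hes : ∀ x, e • s x = s x := fun x => by
    rw [hs_apply, smul_sub, smul_smul, F.idem, ← map_smul f, idem_smul_tr]
  have hρs : ∀ x, ρ (s x) = 0 := fun x => by
    rw [hs_apply, map_sub, tr_idem_smul, hρf _ (F.idem_smul_tr _ _), sub_self]
  have hker : ∀ z, e • z = z → g z = 0 → ρ z = 0 → z = 0 := fun z h₁ h₂ h₃ => by
    obtain ⟨y, rfl⟩ : z ∈ LinearMap.range f := by rw [hfg]; exact h₂
    have : e • y = y := hf (by rw [map_smul, h₁])
    rw [hρf y this] at h₃
    rw [h₃, map_zero]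
  have hlin : ∀ a, e * a = a → a * e = a → ∀ x, s (a • x) = a • s x := fun a h₁ h₂ x => by
    rw [← sub_eq_zero]
    apply hker
    · rw [smul_sub, hes, smul_smul, h₁]
    · rw [map_sub, map_smul g, hgs, hgs, smul_smul, smul_smul, h₁, h₂, sub_self]
    · rw [map_sub, hρs, tr_smul _ _ h₁ h₂, hρs, smul_zero, sub_zero]
  refine ⟨g.restrictScalars k ∘ₗ θN ∘ₗ s, fun x hx => ?_⟩
  rw [← map_tr]
  have : F.tr (θN ∘ₗ s) x = F.tr θN (s x) := by
    simp only [tr_apply, LinearMap.comp_apply]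
    refine Finset.sum_congr rfl fun t _ => ?_
    rw [hlin _ (F.left_b' t) (F.right_b' t)]
  rw [this, hθN _ (hes x), hgs, hx]

/-- Higman's criterion passes to kernels of surjective maps. -/
theorem Higman.of_exact_left (f : L →ₗ[A] N) (g : N →ₗ[A] M) (hf : Function.Injective f)
    (hg : Function.Surjective g) (hfg : LinearMap.range f = LinearMap.ker g)
    (hN : F.Higman N) (hM : F.Higman M) : F.Higman L := by
  obtain ⟨θM, hθM⟩ := hM
  obtain ⟨θN, hθN⟩ := hN
  obtain ⟨r, hr⟩ := (f.restrictScalars k).exists_leftInverse_of_injective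
    (LinearMap.ker_eq_bot.2 hf)
  obtain ⟨s₀, hs₀⟩ := (g.restrictScalars k).exists_rightInverse_of_surjective
    (LinearMap.range_eq_top.2 hg)
  replace hr : ∀ x, r (f x) = x := fun x => LinearMap.congr_fun hr x
  replace hs₀ : ∀ x, g (s₀ x) = x := fun x => LinearMap.congr_fun hs₀ x
  have hgf : ∀ x, g (f x) = 0 := fun x => by
    rw [← LinearMap.mem_ker, ← hfg]; exact LinearMap.mem_range_self f x
  set σ : M →ₗ[k] N := F.tr (s₀ ∘ₗ θM) with hσ
  have hgσ : ∀ x, g (σ x) = e • x := fun x => by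
    have : g.restrictScalars k ∘ₗ s₀ ∘ₗ θM = θM := LinearMap.ext fun y => by simp [hs₀]
    rw [← F.tr_idem_smul, map_tr, this, hθM (e • x) (by rw [smul_smul, F.idem])]
  let ρ : N →ₗ[k] L := r ∘ₗ (Algebra.lsmul k k N e - σ ∘ₗ g.restrictScalars k)
  have hfρ : ∀ z, f (ρ z) = e • z - σ (g z) := fun z => by
    have : e • z - σ (g z) ∈ LinearMap.range f := by
      rw [hfg, LinearMap.mem_ker, map_sub, map_smul, hgσ, sub_self]
    obtain ⟨y, hy⟩ := this
    change f (r (e • z - σ (g z))) = _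
    rw [← hy, hr]
  have hlin : ∀ a, e * a = a → a * e = a → ∀ z, ρ (a • z) = a • ρ z := fun a h₁ h₂ z => by
    apply hf
    rw [hfρ, map_smul g, map_smul f, hfρ, hσ, tr_smul _ _ h₁ h₂, smul_sub, smul_smul, smul_smul, h₁, h₂]
  refine ⟨ρ ∘ₗ θN ∘ₗ f.restrictScalars k, fun x hx => ?_⟩
  have : F.tr (ρ ∘ₗ θN ∘ₗ f.restrictScalars k) x = ρ (F.tr θN (f x)) := by
    simp only [tr_apply, LinearMap.comp_apply, map_sum]
    refine Finset.sum_congr rfl fun t _ => ?_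
    rw [hlin _ (F.left_b t) (F.right_b t)]
    simp
  rw [this, hθN _ (by rw [← map_smul, hx])]
  apply hf
  rw [hfρ, hgf, map_zero, sub_zero, ← map_smul, hx]

end FrobCorner

/-! ## Coinduced modules -/

/-- The module over `A` coinduced from a vector space `W`. -/
def Coind (k A W : Type) [Field k] [Ring A] [Algebra k A] [AddCommGroup W] [Module k W] : Type :=
  A →ₗ[k] W

namespace Coind

variable {k A W : Type} [Field k] [Ring A] [Algebra k A] [AddCommGroup W] [Module k W]

instance : AddCommGroup (Coind k A W) := inferInstanceAs (AddCommGroup (A →ₗ[k] W))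

instance : Module k (Coind k A W) := inferInstanceAs (Module k (A →ₗ[k] W))

instance [Module.Finite k A] [Module.Finite k W] : Module.Finite k (Coind k A W) :=
  inferInstanceAs (Module.Finite k (A →ₗ[k] W))

instance : FunLike (Coind k A W) A W := inferInstanceAs (FunLike (A →ₗ[k] W) A W)

instance : LinearMapClass (Coind k A W) k A W :=
  inferInstanceAs (LinearMapClass (A →ₗ[k] W) k A W)

instance : SMul A (Coind k A W) :=
  ⟨fun a f => LinearMap.comp (M₂ := A) f (LinearMap.mulRight k a)⟩

@[ext] theorem ext {f g : Coind k A W} (h : ∀ x, f x = g x) : f = g := LinearMap.ext h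

@[simp] theorem smul_apply (a : A) (f : Coind k A W) (x : A) : (a • f) x = f (x * a) := rfl

@[simp] theorem add_apply (f g : Coind k A W) (x : A) : (f + g) x = f x + g x := rfl

@[simp] theorem zero_apply (x : A) : (0 : Coind k A W) x = 0 := rfl

@[simp] theorem field_smul_apply (c : k) (f : Coind k A W) (x : A) : (c • f) x = c • f x := rfl

instance : Module A (Coind k A W) where
  one_smul f := by ext; simp
  mul_smul a b f := by ext; simp [mul_assoc]
  smul_zero a := by ext; simp
  smul_add a f g := by ext; simp
  add_smul a b f := by ext; simp [mul_add]
  zero_smul f := by ext; simp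

instance : IsScalarTower k A (Coind k A W) where
  smul_assoc c a f := by ext; simp

@[simp] theorem sum_apply {ι : Type} (s : Finset ι) (f : ι → Coind k A W) (x : A) :
    (∑ i ∈ s, f i) x = ∑ i ∈ s, f i x :=
  LinearMap.sum_apply (M := A) (M₂ := W) s f x

/-- The `A`-linear map into a coinduced module determined by a `k`-linear map. -/
def lift {M : Type} [AddCommGroup M] [Module k M] [Module A M] [IsScalarTower k A M]
    (g : M →ₗ[k] W) : M →ₗ[A] Coind k A W where
  toFun m := g ∘ₗ (LinearMap.toSpanSingleton A M m).restrictScalars k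
  map_add' m n := by
    refine LinearMap.ext fun x => ?_
    change g (x • (m + n)) = g (x • m) + g (x • n)
    rw [smul_add, map_add]
  map_smul' a m := by
    refine LinearMap.ext fun x => ?_
    change g (x • a • m) = g ((x * a) • m)
    rw [smul_smul]

@[simp] theorem lift_apply {M : Type} [AddCommGroup M] [Module k M] [Module A M]
    [IsScalarTower k A M] (g : M →ₗ[k] W) (m : M) (x : A) : lift g m x = g (x • m) := rfl

instance injective : Module.Injective A (Coind k A W) where
  out X Y _ _ _ _ f hf g := by
    let _ : Module k X := Module.compHom X (algebraMap k A)
    let _ : Module k Y := Module.compHom Y (algebraMap k A)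
    have : IsScalarTower k A X := IsScalarTower.of_algebraMap_smul fun _ _ => rfl
    have : IsScalarTower k A Y := IsScalarTower.of_algebraMap_smul fun _ _ => rfl
    let ev : Coind k A W →ₗ[k] W := LinearMap.applyₗ (R := k) (M := A) (1 : A)
    obtain ⟨r, hr⟩ := (f.restrictScalars k).exists_leftInverse_of_injective
      (LinearMap.ker_eq_bot.2 hf)
    refine ⟨lift (ev ∘ₗ g.restrictScalars k ∘ₗ r), fun x => ?_⟩
    ext a
    have : r (a • f x) = a • x := by
      rw [← map_smul]; exact LinearMap.congr_fun hr (a • x)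
    simp only [lift_apply, LinearMap.comp_apply, this]
    change (g (a • x)) 1 = _
    simp

end Coind

theorem Module.Injective.of_retract' {A M N : Type} [Ring A] [AddCommGroup M] [Module A M]
    [AddCommGroup N] [Module A N] (h : Module.Injective A N) (i : M →ₗ[A] N) (p : N →ₗ[A] M)
    (hpi : ∀ x, p (i x) = x) : Module.Injective A M where
  out X Y _ _ _ _ f hf g := by
    obtain ⟨h, hh⟩ := h.out f hf (i ∘ₗ g)
    exact ⟨p ∘ₗ h, fun x => by simp [hh, hpi]⟩

namespace FrobCorner

variable {k : Type} [Field k] {A : Type} [Ring A] [Algebra k A] {e : A} {F : FrobCorner k e}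

/-- Precomposition with a linear endomorphism on a coinduced module. -/
def precomp (W : Type) [AddCommGroup W] [Module k W] (θ : A →ₗ[k] A) :
    Coind k A W →ₗ[k] Coind k A W :=
  LinearMap.lcomp k W θ

theorem precomp_apply (W : Type) [AddCommGroup W] [Module k W] (θ : A →ₗ[k] A)
    (f : Coind k A W) (x : A) : precomp W θ f x = f (θ x) := rfl

theorem RightHigman.coind (h : F.RightHigman) (W : Type) [AddCommGroup W] [Module k W] :
    F.Higman (Coind k A W) := by
  obtain ⟨θ, hθ⟩ := h
  refine ⟨precomp W θ, fun f hf => ?_⟩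
  ext x
  have hfe : f (x * e) = f x := DFunLike.congr_fun hf x
  rw [tr_apply, Coind.sum_apply]
  rw [← hfe]
  conv_rhs => rw [← hθ (x * e) (by rw [mul_assoc, F.idem]), map_sum]
  refine Finset.sum_congr rfl fun s _ => ?_
  rw [Coind.smul_apply, precomp_apply, Coind.smul_apply, mul_assoc, F.left_b]

theorem RightHigman.of_injective (h : F.RightHigman) {M : Type} [AddCommGroup M] [Module k M]
    [Module A M] [IsScalarTower k A M] (hM : Module.Injective A M) : F.Higman M := by
  have hinj : Function.Injective (Coind.lift (A := A) (LinearMap.id (R := k) (M := M))) :=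
    fun x y hxy => by simpa using DFunLike.congr_fun hxy 1
  obtain ⟨p, hp⟩ := hM.out (Coind.lift (LinearMap.id (R := k) (M := M))) hinj LinearMap.id
  exact (h.coind M).of_retract _ p hp

theorem Higman.op_right (h : F.Higman A) : F.op.RightHigman := by
  obtain ⟨θ, hθ⟩ := h
  refine ⟨(MulOpposite.opLinearEquiv k).toLinearMap ∘ₗ θ ∘ₗ
    (MulOpposite.opLinearEquiv k).symm.toLinearMap, fun x hx => ?_⟩
  apply MulOpposite.unop_injective
  have := hθ x.unop (by simpa using congrArg MulOpposite.unop hx)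
  rw [tr_apply] at this
  simp only [op] at *
  simp only [smul_eq_mul] at this
  simp
  exact this

theorem RightHigman.op (h : F.RightHigman) : F.op.Higman Aᵐᵒᵖ := by
  obtain ⟨θ, hθ⟩ := h
  refine ⟨(MulOpposite.opLinearEquiv k).toLinearMap ∘ₗ θ ∘ₗ
    (MulOpposite.opLinearEquiv k).symm.toLinearMap, fun x hx => ?_⟩
  apply MulOpposite.unop_injective
  have := hθ x.unop (by simpa using congrArg MulOpposite.unop hx)
  rw [tr_apply]
  simp only [FrobCorner.op]
  simp
  exact this

variable {M : Type} [AddCommGroup M] [Module k M] [Module A M] [IsScalarTower k A M]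

/-- Modules of finite projective dimension satisfy Higman's criterion. -/
theorem Higman.of_hasProjDimLE (h : F.Higman A) (n : ℕ) :
    ∀ (M : ModuleCat.{0} A) [Module k M] [IsScalarTower k A M], HasProjDimLE A n M → F.Higman M := by
  induction n with
  | zero =>
    intro M _ _ hM
    have : Module.Projective A M := hM
    exact h.of_projective hM
  | succ n ih =>
    rintro M _ _ ⟨P, f, hP, hf, hK⟩
    let _ : Module k P := Module.compHom P (algebraMap k A)
    have : IsScalarTower k A P := IsScalarTower.of_algebraMap_smul fun _ _ => rfl
    have hK' : F.Higman (LinearMap.ker f) := ih (ModuleCat.of A (LinearMap.ker f)) hK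
    exact hK'.of_exact_right (LinearMap.ker f).subtype f (Submodule.subtype_injective _) hf
      (Submodule.range_subtype _) (h.of_projective hP)

/-- Modules of finite injective dimension satisfy Higman's criterion. -/
theorem RightHigman.of_hasInjDimLE (h : F.RightHigman) (n : ℕ) :
    ∀ (M : ModuleCat.{0} A) [Module k M] [IsScalarTower k A M], HasInjDimLE A n M → F.Higman M := by
  induction n with
  | zero =>
    intro M _ _ hM
    exact h.of_injective hM
  | succ n ih =>
    rintro M _ _ ⟨I, f, hI, hf, hC⟩
    let _ : Module k I := Module.compHom I (algebraMap k A)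
    have : IsScalarTower k A I := IsScalarTower.of_algebraMap_smul fun _ _ => rfl
    have hC' : F.Higman (I ⧸ LinearMap.range f) :=
      ih (ModuleCat.of A (I ⧸ LinearMap.range f)) hC
    exact Higman.of_exact_left f (LinearMap.range f).mkQ hf (Submodule.mkQ_surjective _)
      (Submodule.ker_mkQ _).symm (h.of_injective hI) hC'

end FrobCorner

end

section

/-! ## Frames of corners of modules -/

/-- The corner `eAe` as a subspace. -/
def cornerSub (k : Type) [Field k] {A : Type} [Ring A] [Algebra k A] (e : A) : Submodule k A where
  carrier := {x | e * x = x ∧ x * e = x}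
  add_mem' := fun ⟨h₁, h₂⟩ ⟨h₃, h₄⟩ => ⟨by rw [mul_add, h₁, h₃], by rw [add_mul, h₂, h₄]⟩
  zero_mem' := ⟨mul_zero e, zero_mul e⟩
  smul_mem' c x := fun ⟨h₁, h₂⟩ => ⟨by rw [mul_smul_comm, h₁], by rw [smul_mul_assoc, h₂]⟩

/-- The subspace `eM` of an `A`-module `M`. -/
def fixSub (k : Type) [Field k] {A : Type} [Ring A] [Algebra k A] (e : A) (M : Type)
    [AddCommGroup M] [Module k M] [Module A M] [IsScalarTower k A M] : Submodule k M where
  carrier := {m | e • m = m}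
  add_mem' := fun {a b} (h₁ : e • a = a) (h₂ : e • b = b) => by
    change e • (a + b) = a + b
    rw [smul_add, h₁, h₂]
  zero_mem' := smul_zero e
  smul_mem' c x := fun (h : e • x = x) => by
    change e • c • x = c • x
    rw [smul_algebra_smul_comm, h]

section

variable {k : Type} [Field k] {A : Type} [Ring A] [Algebra k A] {e : A}

theorem mem_fixSub {M : Type} [AddCommGroup M] [Module k M] [Module A M] [IsScalarTower k A M]
    {x : M} : x ∈ fixSub k e M ↔ e • x = x := Iff.rfl

theorem mul_mem_cornerSub (he : e * e = e) (x : A) : e * x * e ∈ cornerSub k e :=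
  ⟨by rw [← mul_assoc, ← mul_assoc, he], by rw [mul_assoc, he]⟩

end

/-- A finite basis of `eM` over the corner algebra `eAe`. -/
structure Frame (k : Type) [Field k] {A : Type} [Ring A] [Algebra k A] (e : A) (M : Type)
    [AddCommGroup M] [Module k M] [Module A M] : Type 1 where
  T : Type
  [fintype : Fintype T]
  x : T → M
  coord : T → M →ₗ[k] A
  idem_smul_x : ∀ t, e • x t = x t
  coord_mem : ∀ t m, coord t m ∈ cornerSub k e
  sum_coord : ∀ m, ∑ t, coord t m • x t = e • m
  coord_sum : ∀ a : T → A, (∀ t, a t ∈ cornerSub k e) → ∀ s, coord s (∑ t, a t • x t) = a s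

attribute [instance] Frame.fintype

namespace Frame

variable {k : Type} [Field k] {A : Type} [Ring A] [Algebra k A] {e : A}
variable {M : Type} [AddCommGroup M] [Module k M] [Module A M]

theorem coord_idem (f : Frame k e M) (t : f.T) (m : M) : f.coord t (e • m) = f.coord t m := by
  rw [← f.sum_coord, f.coord_sum _ fun t => f.coord_mem t m]

theorem coord_smul (f : Frame k e M) {a : A} (ha : a ∈ cornerSub k e) (t : f.T) (m : M) :
    f.coord t (a • m) = a * f.coord t m := by
  have : a • m = ∑ t, (a * f.coord t m) • f.x t := by
    simp only [mul_smul, ← Finset.smul_sum, f.sum_coord]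
    rw [smul_smul, ha.2]
  rw [this, f.coord_sum _ fun t => ⟨by rw [← mul_assoc, ha.1], by rw [mul_assoc, (f.coord_mem t m).2]⟩]

variable [IsScalarTower k A M]

/-- A family of elements over which `eM` is freely generated gives rise to a frame. -/
theorem nonempty_of_bijective (he : e * e = e) {T : Type} [Fintype T] (x : T → M)
    (hx : ∀ t, e • x t = x t)
    (hsurj : ∀ m, e • m = m → ∃ a : T → A, (∀ t, a t ∈ cornerSub k e) ∧ ∑ t, a t • x t = m)
    (hinj : ∀ a : T → A, (∀ t, a t ∈ cornerSub k e) → ∑ t, a t • x t = 0 → ∀ t, a t = 0) :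
    Nonempty (Frame k e M) := by
  let Ψ : (T → cornerSub k e) →ₗ[k] fixSub k e M :=
    { toFun := fun a => ⟨∑ t, (a t : A) • x t, by
        rw [mem_fixSub, Finset.smul_sum]
        exact Finset.sum_congr rfl fun t _ => by rw [smul_smul, (a t).2.1]⟩
      map_add' := fun a b => Subtype.ext (by simp [add_smul, Finset.sum_add_distrib])
      map_smul' := fun c a => Subtype.ext (by simp [Finset.smul_sum]) }
  have hΨ : ∀ a, (Ψ a : M) = ∑ t, (a t : A) • x t := fun _ => rfl
  have hbij : Function.Bijective Ψ := by
    constructor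
    · rw [← LinearMap.ker_eq_bot, LinearMap.ker_eq_bot']
      intro a ha
      ext t
      exact hinj (fun t => a t) (fun t => (a t).2) (by rw [← hΨ, ha]; rfl) t
    · rintro ⟨m, hm⟩
      obtain ⟨a, ha, h⟩ := hsurj m hm
      exact ⟨fun t => ⟨a t, ha t⟩, Subtype.ext h⟩
  let Φ := LinearEquiv.ofBijective Ψ hbij
  let E : M →ₗ[k] fixSub k e M := (Algebra.lsmul k k M e).codRestrict _ fun m => by
    rw [mem_fixSub]; simp [smul_smul, he]
  have hE : ∀ m, (E m : M) = e • m := fun _ => rfl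
  refine ⟨{
    T := T
    x := x
    coord := fun t => (cornerSub k e).subtype ∘ₗ LinearMap.proj t ∘ₗ Φ.symm.toLinearMap ∘ₗ E
    idem_smul_x := hx
    coord_mem := fun t m => (Φ.symm (E m) t).2
    sum_coord := fun m => ?_
    coord_sum := fun a ha s => ?_ }⟩
  · rw [← hE]
    conv_rhs => rw [← Φ.apply_symm_apply (E m)]
    rfl
  · have : E (∑ t, a t • x t) = Φ fun t => ⟨a t, ha t⟩ := by
      apply Subtype.ext
      rw [hE, Finset.smul_sum]
      exact Finset.sum_congr rfl fun t _ => by rw [smul_smul, (ha t).1]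
    change (Φ.symm (E (∑ t, a t • x t)) s : A) = a s
    rw [this, Φ.symm_apply_apply]

theorem higman (f : Frame k e M) (F : FrobCorner k e) : F.Higman M := by
  refine ⟨∑ t, LinearMap.smulRight (F.form ∘ₗ f.coord t) (f.x t), fun m hm => ?_⟩
  rw [F.tr_apply]
  simp only [LinearMap.sum_apply, LinearMap.smulRight_apply, LinearMap.comp_apply,
    Finset.smul_sum]
  rw [Finset.sum_comm]
  conv_rhs => rw [← hm, ← f.sum_coord]
  refine Finset.sum_congr rfl fun t _ => ?_
  conv_rhs => rw [← F.sum_left _ (f.coord_mem t m).1 (f.coord_mem t m).2, Finset.sum_smul]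
  refine Finset.sum_congr rfl fun s _ => ?_
  rw [f.coord_smul ⟨F.left_b' s, F.right_b' s⟩, smul_assoc, smul_algebra_smul_comm]

end Frame

/-- Over a local Frobenius corner, Higman's criterion implies freeness. -/
theorem FrobCorner.Higman.nonempty_frame {k : Type} [Field k] {A : Type} [Ring A] [Algebra k A]
    {e : A} {F : FrobCorner k e} {M : Type} [AddCommGroup M] [Module k M] [Module A M]
    [IsScalarTower k A M] [Module.Finite k M] (h : F.Higman M)
    (J : Submodule k A) (hJl : ∀ a, ∀ x ∈ J, a * x ∈ J)
    (hJ : ∃ m, J ^ m = ⊥) (hloc : ∀ x ∈ cornerSub k e, ∃ c : k, x - c • e ∈ J) :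
    Nonempty (Frame k e M) := by
  obtain ⟨θ, hθ⟩ := h
  obtain ⟨m, hm⟩ := hJ
  have hec : e ∈ cornerSub k e := ⟨F.idem, F.idem⟩
  have hmulc : ∀ {a b}, a ∈ cornerSub k e → b ∈ cornerSub k e → a * b ∈ cornerSub k e :=
    fun ha hb => ⟨by rw [← mul_assoc, ha.1], by rw [mul_assoc, hb.2]⟩
  let L : Submodule k M :=
    Submodule.span k {y | ∃ a ∈ J, a ∈ cornerSub k e ∧ ∃ z, e • z = z ∧ y = a • z}
  let X := fixSub k e M
  let L' : Submodule k X := L.comap X.subtype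
  let B := Module.finBasis k (X ⧸ L')
  let T := Fin (Module.finrank k (X ⧸ L'))
  choose xs hxs using fun t : T => Submodule.mkQ_surjective L' (B t)
  let x : T → M := fun t => xs t
  have hx : ∀ t, e • x t = x t := fun t => (xs t).2
  have hspan : ∀ z, e • z = z → ∃ c : T → k, z - ∑ t, c t • x t ∈ L := fun z hz => by
    refine ⟨B.repr (L'.mkQ ⟨z, hz⟩), ?_⟩
    have : L'.mkQ (⟨z, hz⟩ - ∑ t, B.repr (L'.mkQ ⟨z, hz⟩) t • xs t) = 0 := by
      simp only [map_sub, map_sum, map_smul, hxs, B.sum_repr, sub_self]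
    rw [Submodule.mkQ_apply, Submodule.Quotient.mk_eq_zero] at this
    simpa [L'] using this
  have hindep : ∀ c : T → k, ∑ t, c t • x t ∈ L → c = 0 := fun c hc => by
    have : L'.mkQ (∑ t, c t • xs t) = 0 := by
      rw [Submodule.mkQ_apply, Submodule.Quotient.mk_eq_zero]
      simpa [L'] using hc
    simp only [map_sum, map_smul, hxs] at this
    exact funext (Fintype.linearIndependent_iff.1 B.linearIndependent c this)
  let π : (T → A) →ₗ[A] M := Fintype.linearCombination A x
  have hπ : ∀ a, π a = ∑ t, a t • x t := fun a => Fintype.linearCombination_apply A x a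
  let Y : Submodule k M := Submodule.map (π.restrictScalars k)
    (Submodule.pi Set.univ fun _ => cornerSub k e)
  have hY : ∀ y, y ∈ Y ↔ ∃ a : T → A, (∀ t, a t ∈ cornerSub k e) ∧ π a = y := fun y => by
    simp [Y, Submodule.mem_pi]
  have hYx : ∀ a ∈ cornerSub k e, ∀ t, a • x t ∈ Y := fun a ha t => by
    rw [hY]
    refine ⟨Pi.single t a, fun s => ?_, ?_⟩
    · rcases eq_or_ne s t with rfl | hst
      · simpa using ha
      · simp [Pi.single_eq_of_ne hst]
    · rw [hπ, Finset.sum_eq_single t] <;> simp +contextual [Pi.single_eq_of_ne]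
  have hYspan : ∀ z, e • z = z → ∀ a ∈ cornerSub k e, (∀ l ∈ L, a • l ∈ Y) → a • z ∈ Y := by
    intro z hz a ha hl
    obtain ⟨c, hc⟩ := hspan z hz
    have : a • z = ∑ t, c t • (a • x t) + a • (z - ∑ t, c t • x t) := by
      simp only [smul_sub, Finset.smul_sum, smul_algebra_smul_comm, add_sub_cancel]
    rw [this]
    exact Y.add_mem (Y.sum_mem fun t _ => Y.smul_mem _ (hYx a ha t)) (hl _ hc)
  have hYpow : ∀ d j, m ≤ j + d → ∀ a ∈ J ^ j, a ∈ cornerSub k e → ∀ z, e • z = z → a • z ∈ Y := by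
    intro d
    induction d with
    | zero =>
      intro j hj a ha _ z _
      have : J ^ j = ⊥ := by
        obtain ⟨i, rfl⟩ := Nat.exists_eq_add_of_le hj
        simp only [pow_add, hm]
        exact Submodule.bot_mul _
      rw [this, Submodule.mem_bot] at ha
      simp [ha]
    | succ d ih =>
      intro j hj a ha hac z hz
      refine hYspan z hz a hac fun l hl => ?_
      induction hl using Submodule.span_induction with
      | mem y hy =>
        obtain ⟨b, hb, hbc, w, hw, rfl⟩ := hy
        rw [smul_smul]
        exact ih (j + 1) (by omega) _ (by rw [pow_succ]; exact Submodule.mul_mem_mul ha hb)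
          (hmulc hac hbc) w hw
      | zero => simp
      | add u v _ _ hu hv => rw [smul_add]; exact Y.add_mem hu hv
      | smul c u _ hu => rw [smul_algebra_smul_comm]; exact Y.smul_mem _ hu
  have hYall : ∀ z, e • z = z → z ∈ Y := fun z hz => by
    rw [← hz]
    refine hYspan z hz e hec fun l hl => ?_
    induction hl using Submodule.span_induction with
    | mem y hy =>
      obtain ⟨b, hb, hbc, w, hw, rfl⟩ := hy
      rw [smul_smul]
      exact hYpow m 1 (by omega) _ (by rw [pow_one]; exact hJl e b hb) (hmulc hec hbc) w hw
    | zero => simp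
    | add u v _ _ hu hv => rw [smul_add]; exact Y.add_mem hu hv
    | smul c u _ hu => rw [smul_algebra_smul_comm]; exact Y.smul_mem _ hu
  have hker : ∀ a : T → A, (∀ t, a t ∈ cornerSub k e) → π a = 0 → ∀ t, a t ∈ J := by
    intro a ha h0
    choose c hc using fun t => hloc (a t) (ha t)
    have hcc : ∀ t, a t - c t • e ∈ cornerSub k e := fun t =>
      Submodule.sub_mem _ (ha t) (Submodule.smul_mem _ _ hec)
    have : c = 0 := by
      apply hindep
      have h1 : ∑ t, c t • x t = - ∑ t, (a t - c t • e) • x t := by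
        simp only [sub_smul, Finset.sum_sub_distrib, ← hπ, h0, smul_assoc, hx]
        simp
      rw [h1]
      exact L.neg_mem (L.sum_mem fun t _ =>
        Submodule.subset_span ⟨_, hc t, hcc t, x t, hx t, rfl⟩)
    intro t
    simpa [this] using hc t
  obtain ⟨s₀, hs₀, hs₀π⟩ : ∃ s₀ : M →ₗ[k] (T → A), (∀ z t, s₀ z t ∈ cornerSub k e) ∧
      ∀ z, π (s₀ z) = e • z := by
    let P : Submodule k (T → A) := Submodule.pi Set.univ fun _ => cornerSub k e
    obtain ⟨r, hr⟩ := ((π.restrictScalars k).submoduleMap P).exists_rightInverse_of_surjective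
      (LinearMap.range_eq_top.2 (LinearMap.submoduleMap_surjective _ _))
    let E : M →ₗ[k] Y := (Algebra.lsmul k k M e).codRestrict Y fun z =>
      hYall _ (by simp [smul_smul, F.idem])
    refine ⟨P.subtype ∘ₗ r ∘ₗ E, fun z t => ?_, fun z => ?_⟩
    · have := (r (E z)).2
      rw [Submodule.mem_pi] at this
      exact this t (Set.mem_univ t)
    · exact congrArg Subtype.val (LinearMap.congr_fun hr (E z))
  let s : M →ₗ[k] (T → A) := F.tr (s₀ ∘ₗ θ)
  have hsc : ∀ z t, s z t ∈ cornerSub k e := fun z t => by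
    refine ⟨congrFun (F.idem_smul_tr (s₀ ∘ₗ θ) z) t, ?_⟩
    simp only [s, F.tr_apply, Finset.sum_apply, Finset.sum_mul, Pi.smul_apply, smul_eq_mul]
    refine Finset.sum_congr rfl fun i _ => ?_
    rw [mul_assoc]
    exact congrArg _ (hs₀ _ t).2
  have hπs : ∀ z, e • z = z → π (s z) = z := fun z hz => by
    rw [F.map_tr]
    conv_rhs => rw [← hθ z hz]
    simp only [F.tr_apply, LinearMap.comp_apply, LinearMap.restrictScalars_apply, hs₀π, smul_smul,
      F.right_b]
  refine Frame.nonempty_of_bijective F.idem x hx (fun z hz => ?_) fun a ha h0 => ?_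
  · obtain ⟨a, ha, h⟩ := (hY z).1 (hYall z hz)
    exact ⟨a, ha, by rw [← hπ, h]⟩
  · have hδ : ∀ t u, (Pi.single t e - s (x t) : T → A) u ∈ J := fun t => by
      apply hker
      · intro u
        refine Submodule.sub_mem _ ?_ (hsc _ u)
        rcases eq_or_ne u t with rfl | hut
        · simpa using hec
        · simp [Pi.single_eq_of_ne hut]
      · rw [map_sub, hπs _ (hx t), hπ, Finset.sum_eq_single t] <;>
          simp +contextual [Pi.single_eq_of_ne, hx]
    have hdecomp : a = ∑ t, a t • (Pi.single t e - s (x t) : T → A) := by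
      have h1 : ∑ t, a t • s (x t) = 0 := by
        simp only [s, ← F.tr_smul _ (ha _).1 (ha _).2]
        rw [← map_sum, h0, map_zero]
      simp only [smul_sub, Finset.sum_sub_distrib, h1, sub_zero]
      ext u
      rw [Finset.sum_apply, Finset.sum_eq_single u]
      · simp [(ha u).2]
      · intro b _ hb; simp [Pi.single_eq_of_ne hb.symm]
      · simp
    have hpow : ∀ j, ∀ t, a t ∈ J ^ (j + 1) := by
      intro j
      induction j with
      | zero => simpa using hker a ha (by rw [hπ, h0])
      | succ j ih =>
        intro t
        rw [hdecomp, Finset.sum_apply]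
        refine Submodule.sum_mem _ fun u _ => ?_
        rw [pow_succ, Pi.smul_apply, smul_eq_mul]
        exact Submodule.mul_mem_mul (ih u) (hδ u t)
    intro t
    have := hpow m t
    rw [pow_succ, hm, Submodule.bot_mul] at this
    simpa using this

end

section

/-! ## Directed systems of Frobenius corners and finite resolutions -/

/-- A complete system of orthogonal idempotents, directed by a height function, with local
Frobenius corners over which the algebra is projective on both sides. -/
structure FrobSystem (k A V : Type) [Field k] [Ring A] [Algebra k A] [Fintype V] : Type where
  e : V → A
  idem : CompleteOrthogonalIdempotents e
  frob : ∀ i, FrobCorner k (e i)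
  left : ∀ i, (frob i).Higman A
  right : ∀ i, (frob i).RightHigman
  h : V → ℕ
  dir : ∀ i j, i ≠ j → ¬ h i < h j → ∀ a, e j * a * e i = 0
  J : Submodule k A
  mul_mem : ∀ a, ∀ x ∈ J, a * x ∈ J
  mul_mem' : ∀ a, ∀ x ∈ J, x * a ∈ J
  nilp : ∃ m, J ^ m = ⊥
  loc : ∀ i, ∀ x ∈ cornerSub k (e i), ∃ c : k, x - c • e i ∈ J

theorem Frame.coord_smul_x {k : Type} [Field k] {A : Type} [Ring A] [Algebra k A] {e : A}
    {M : Type} [AddCommGroup M] [Module k M] [Module A M] (f : Frame k e M) {a : A}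
    (ha : a ∈ cornerSub k e) (t : f.T) : f.coord t (a • f.x t) = a := by
  classical
  have := f.coord_sum (Pi.single t a) (fun s => by
    rcases eq_or_ne s t with rfl | hst
    · simpa using ha
    · simp [Pi.single_eq_of_ne hst]) t
  rwa [Finset.sum_eq_single t (by simp +contextual [Pi.single_eq_of_ne]) (by simp),
    Pi.single_eq_same] at this

theorem Frame.idem_eq_zero {k : Type} [Field k] {A : Type} [Ring A] [Algebra k A] {e : A}
    {M : Type} [AddCommGroup M] [Module k M] [Module A M] (f : Frame k e M) (he : e * e = e)
    (t : f.T) (h : ∀ m : M, e • m = m → m = 0) : e = 0 := by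
  rw [← f.coord_smul_x (a := e) ⟨he, he⟩ t, h _ (f.idem_smul_x t), smul_zero, map_zero]

namespace FrobSystem

variable {k A V : Type} [Field k] [Ring A] [Algebra k A] [Fintype V] (S : FrobSystem k A V)

theorem eq_zero_of_idem_smul {M : Type} [AddCommGroup M] [Module A M]
    (h : ∀ i, ∀ m : M, S.e i • m = m → m = 0) (m : M) : m = 0 := by
  rw [← one_smul A m, ← S.idem.complete, Finset.sum_smul]
  exact Finset.sum_eq_zero fun i _ => h i _ (by rw [smul_smul, (S.idem.idem i).eq])

theorem higman_frame {M : Type} [AddCommGroup M] [Module k M] [Module A M] [IsScalarTower k A M]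
    [Module.Finite k M] {i : V} (h : (S.frob i).Higman M) : Nonempty (Frame k (S.e i) M) :=
  h.nonempty_frame S.J S.mul_mem S.nilp (S.loc i)

theorem hasProjDimLE_of_support [Module.Finite k A] (H : ℕ) (hH : ∀ i, S.h i < H) (t : ℕ) :
    ∀ (M : Type) [AddCommGroup M] [Module k M] [Module A M] [IsScalarTower k A M]
      [Module.Finite k M], (∀ i, (S.frob i).Higman M) →
      (∀ i, S.h i + t < H → ∀ m : M, S.e i • m = m → m = 0) →
      HasProjDimLE A t (ModuleCat.of A M) := by
  classical
  induction t with
  | zero =>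
    intro M _ _ _ _ _ _ hs
    have : Subsingleton M := subsingleton_of_forall_eq 0 (S.eq_zero_of_idem_smul fun i =>
      hs i (by simpa using hH i))
    exact (inferInstance : Module.Projective A M)
  | succ t ih =>
    intro M _ _ _ _ _ hM hs
    have fr := fun i => Classical.choice (S.higman_frame (hM i))
    let T := Σ i, (fr i).T
    let p : (T → A) →ₗ[A] (T → A) := LinearMap.pi fun τ =>
      LinearMap.toSpanSingleton A A (S.e τ.1) ∘ₗ LinearMap.proj τ
    have hp : ∀ f τ, p f τ = f τ * S.e τ.1 := fun _ _ => rfl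
    let P : Submodule A (T → A) := LinearMap.eqLocus p LinearMap.id
    have hP : ∀ f : P, ∀ τ, f.1 τ * S.e τ.1 = f.1 τ := fun f τ => congrFun f.2 τ
    let r : (T → A) →ₗ[A] P := p.codRestrict P fun f => by
      change p (p f) = p f
      ext τ
      rw [hp, hp, mul_assoc, (S.idem.idem τ.1).eq]
    have hPproj : Module.Projective A P :=
      Module.Projective.of_split P.subtype r (LinearMap.ext fun f => Subtype.ext f.2)
    let π : P →ₗ[A] M := Fintype.linearCombination A (fun τ : T => (fr τ.1).x τ.2) ∘ₗ P.subtype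
    have hπ : ∀ f : P, π f = ∑ i, ∑ t, f.1 ⟨i, t⟩ • (fr i).x t := fun f => by
      rw [← Fintype.sum_sigma']; rfl
    have hπs : Function.Surjective π := fun m => by
      refine ⟨⟨fun τ => (fr τ.1).coord τ.2 m, funext fun τ => ((fr τ.1).coord_mem τ.2 m).2⟩, ?_⟩
      rw [hπ]
      simp only [(fr _).sum_coord]
      rw [← Finset.sum_smul, S.idem.complete, one_smul]
    have : Module.Finite k (LinearMap.ker π) :=
      Module.Finite.of_injective
        ((P.subtype ∘ₗ (LinearMap.ker π).subtype).restrictScalars k)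
        ((Submodule.subtype_injective _).comp (Submodule.subtype_injective _))
    refine ⟨ModuleCat.of A P, π, hPproj, hπs, ih (LinearMap.ker π) (fun i =>
      FrobCorner.Higman.of_exact_left (LinearMap.ker π).subtype π (Submodule.subtype_injective _) hπs
        (Submodule.range_subtype _) ((S.left i).of_projective hPproj) (hM i)) ?_⟩
    intro j hj f hf
    have hf' : ∀ τ, S.e j * f.1.1 τ = f.1.1 τ := fun τ =>
      congrFun (congrArg (fun g => g.1.1) hf) τ
    have hne : ∀ τ : T, τ.1 ≠ j → f.1.1 τ = 0 := fun τ hτ => by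
      by_cases hh : S.h τ.1 < S.h j
      · rw [← hP f.1 τ, (fr τ.1).idem_eq_zero (S.idem.idem _).eq τ.2 (hs _ (by omega)), mul_zero]
      · have := S.dir _ _ hτ hh (f.1.1 τ)
        rwa [hf', hP] at this
    have h0 : ∑ t, f.1.1 ⟨j, t⟩ • (fr j).x t = 0 := by
      have h1 : π f.1 = 0 := f.2
      rw [hπ, Finset.sum_eq_single j _ (by simp)] at h1
      · exact h1
      · intro i _ hi
        exact Finset.sum_eq_zero fun t _ => by rw [hne ⟨i, t⟩ hi, zero_smul]
    apply Subtype.ext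
    apply Subtype.ext
    ext ⟨i, t⟩
    rcases eq_or_ne i j with rfl | hi
    · have := (fr i).coord_sum (fun t => f.1.1 ⟨i, t⟩) (fun t => ⟨hf' _, hP f.1 ⟨i, t⟩⟩) t
      rw [h0, map_zero] at this
      exact this.symm
    · exact hne _ hi

theorem finite_quotient {k A M : Type} [Field k] [Ring A] [Algebra k A] [AddCommGroup M]
    [Module k M] [Module A M] [IsScalarTower k A M] [Module.Finite k M] (N : Submodule A M) :
    Module.Finite k (M ⧸ N) :=
  Module.Finite.of_surjective (N.mkQ.restrictScalars k) (Submodule.mkQ_surjective _)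

theorem hasInjDimLE_of_support [Module.Finite k A] (t : ℕ) :
    ∀ (M : Type) [AddCommGroup M] [Module k M] [Module A M] [IsScalarTower k A M]
      [Module.Finite k M], (∀ i, (S.frob i).Higman M) →
      (∀ i, t ≤ S.h i → ∀ m : M, S.e i • m = m → m = 0) →
      HasInjDimLE A t (ModuleCat.of A M) := by
  classical
  induction t with
  | zero =>
    intro M _ _ _ _ _ _ hs
    have : Subsingleton M := subsingleton_of_forall_eq 0 (S.eq_zero_of_idem_smul fun i =>
      hs i (Nat.zero_le _))
    exact (⟨fun X Y _ _ _ _ f hf g => ⟨0, fun x => Subsingleton.elim _ _⟩⟩ : Module.Injective A M)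
  | succ t ih =>
    intro M _ _ _ _ _ hM hs
    have fr := fun i => Classical.choice (S.higman_frame (hM i))
    let T := Σ i, (fr i).T
    let C := Coind k A (T → k)
    let q : C →ₗ[k] (T → k) := LinearMap.pi fun τ =>
      LinearMap.proj τ ∘ₗ LinearMap.applyₗ (R := k) (M := A) (S.e τ.1)
    let p : C →ₗ[A] C := Coind.lift q
    have hp : ∀ (F : C) x τ, p F x τ = F (S.e τ.1 * x) τ := fun _ _ _ => rfl
    let I : Submodule A C := LinearMap.eqLocus p LinearMap.id
    have hI : ∀ F : I, ∀ x τ, F.1 (S.e τ.1 * x) τ = F.1 x τ := fun F x τ =>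
      congrFun (DFunLike.congr_fun F.2 x) τ
    have hIm : ∀ F : C, (∀ x τ, F (S.e τ.1 * x) τ = F x τ) → F ∈ I := fun F h =>
      Coind.ext fun x => funext fun τ => h x τ
    let r : C →ₗ[A] I := p.codRestrict I fun F => hIm _ fun x τ => by
      rw [hp, hp, ← mul_assoc, (S.idem.idem τ.1).eq]
    have hIinj : Module.Injective A I := Module.Injective.of_retract' Coind.injective I.subtype r
      fun F => Subtype.ext F.2
    let g : M →ₗ[k] (T → k) := LinearMap.pi fun τ => (S.frob τ.1).form ∘ₗ (fr τ.1).coord τ.2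
    let ι : M →ₗ[A] I := (Coind.lift g).codRestrict I fun m => hIm _ fun x τ => by
      change (S.frob τ.1).form ((fr τ.1).coord τ.2 ((S.e τ.1 * x) • m)) =
        (S.frob τ.1).form ((fr τ.1).coord τ.2 (x • m))
      rw [mul_smul, (fr τ.1).coord_idem]
    have hι : ∀ m x i t, (ι m).1 x ⟨i, t⟩ = (S.frob i).form ((fr i).coord t (x • m)) :=
      fun _ _ _ _ => rfl
    have hιi : Function.Injective ι := by
      rw [← LinearMap.ker_eq_bot, LinearMap.ker_eq_bot']
      intro m hm
      have hc : ∀ i t, (fr i).coord t m = 0 := fun i t => by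
        obtain ⟨h1, h2⟩ := (fr i).coord_mem t m
        rw [← (S.frob i).sum_left _ h1 h2]
        refine Finset.sum_eq_zero fun s _ => ?_
        have h3 : (ι m).1 ((S.frob i).b' s) ⟨i, t⟩ = 0 := by rw [hm]; rfl
        rw [hι, (fr i).coord_smul ⟨(S.frob i).left_b' s, (S.frob i).right_b' s⟩] at h3
        rw [h3, zero_smul]
      rw [← one_smul A m, ← S.idem.complete, Finset.sum_smul]
      refine Finset.sum_eq_zero fun i _ => ?_
      rw [← (fr i).sum_coord]
      exact Finset.sum_eq_zero fun t _ => by rw [hc, zero_smul]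
    have : Module.Finite k I :=
      Module.Finite.of_injective (I.subtype.restrictScalars k) (Submodule.subtype_injective _)
    have : Module.Finite k (I ⧸ LinearMap.range ι) :=
      finite_quotient (LinearMap.range ι)
    refine ⟨ModuleCat.of A I, ι, hIinj, hιi, ih (I ⧸ LinearMap.range ι) (fun i =>
      FrobCorner.Higman.of_exact_right ι (LinearMap.range ι).mkQ hιi (Submodule.mkQ_surjective _)
        (Submodule.ker_mkQ _).symm (hM i) ((S.right i).of_injective hIinj)) ?_⟩
    intro j hj c hc
    obtain ⟨F₀, rfl⟩ := Submodule.mkQ_surjective _ c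
    rw [← hc, ← map_smul]
    set F : I := S.e j • F₀ with hF
    have hFe : ∀ x, F.1 (x * S.e j) = F.1 x := fun x => by
      change F₀.1 (x * S.e j * S.e j) = F₀.1 (x * S.e j)
      rw [mul_assoc, (S.idem.idem j).eq]
    have hne : ∀ i (_ : (fr i).T), i ≠ j → ∀ x, S.e i * x * S.e j = 0 := fun i t hi x => by
      by_cases hh : S.h j < S.h i
      · rw [(fr i).idem_eq_zero (S.idem.idem _).eq t (hs _ (by omega)), zero_mul, zero_mul]
      · exact S.dir _ _ hi.symm hh x
    rw [Submodule.mkQ_apply, Submodule.Quotient.mk_eq_zero]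
    let a : (fr j).T → A := fun t =>
      ∑ s, F.1 ((S.frob j).b' s) ⟨j, t⟩ • (S.frob j).b s
    have ha : ∀ t, a t ∈ cornerSub k (S.e j) := fun t =>
      Submodule.sum_mem _ fun s _ => Submodule.smul_mem _ _
        ⟨(S.frob j).left_b s, (S.frob j).right_b s⟩
    let m : M := ∑ t, a t • (fr j).x t
    have hm : S.e j • m = m := by
      rw [Finset.smul_sum]
      exact Finset.sum_congr rfl fun t _ => by rw [smul_smul, (ha t).1]
    refine ⟨m, ?_⟩
    apply Subtype.ext
    apply Coind.ext
    intro x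
    ext ⟨i, t⟩
    rw [hι, ← hI F, ← hFe, ← (fr i).coord_idem, ← hm, smul_smul, smul_smul]
    change (S.frob i).form ((fr i).coord t ((S.e i * x * S.e j) • m)) =
      F.1 (S.e i * x * S.e j) ⟨i, t⟩
    rcases eq_or_ne i j with rfl | hi
    · have hy := mul_mem_cornerSub (k := k) (S.idem.idem i).eq x
      rw [(fr i).coord_smul hy, (fr i).coord_sum a ha]
      conv_rhs => rw [← (S.frob i).sum_right _ hy.1 hy.2]
      rw [Finset.mul_sum, map_sum, map_sum, Finset.sum_apply]
      refine Finset.sum_congr rfl fun s _ => ?_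
      rw [mul_smul_comm, map_smul, map_smul, Pi.smul_apply, smul_eq_mul, smul_eq_mul, mul_comm]
    · rw [hne i t hi, zero_smul, map_zero, map_zero, map_zero]
      rfl

theorem exists_bound : ∃ H, ∀ i, S.h i < H :=
  ⟨∑ i, S.h i + 1, fun i => Nat.lt_succ_of_le (Finset.single_le_sum (f := S.h)
    (fun _ _ => Nat.zero_le _) (Finset.mem_univ i))⟩

variable [Module.Finite k A] (M : Type) [AddCommGroup M] [Module k M] [Module A M]
  [IsScalarTower k A M] [Module.Finite k M]

theorem exists_hasProjDimLE_iff :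
    (∃ n, HasProjDimLE A n (ModuleCat.of A M)) ↔ ∀ i, (S.frob i).Higman M := by
  constructor
  · rintro ⟨n, hn⟩ i
    exact (S.left i).of_hasProjDimLE n (ModuleCat.of A M) hn
  · intro h
    obtain ⟨H, hH⟩ := S.exists_bound
    exact ⟨H, S.hasProjDimLE_of_support H hH H M h fun i hi => absurd hi (by omega)⟩

theorem exists_hasInjDimLE_iff :
    (∃ n, HasInjDimLE A n (ModuleCat.of A M)) ↔ ∀ i, (S.frob i).Higman M := by
  constructor
  · rintro ⟨n, hn⟩ i
    exact (S.right i).of_hasInjDimLE n (ModuleCat.of A M) hn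
  · intro h
    obtain ⟨H, hH⟩ := S.exists_bound
    exact ⟨H, S.hasInjDimLE_of_support H M h fun i hi => absurd hi (by have := hH i; omega)⟩

end FrobSystem

end

section

namespace FrobSystem

variable {k A V : Type} [Field k] [Ring A] [Algebra k A] [Fintype V] (S : FrobSystem k A V)

open MulOpposite

/-- The opposite system. -/
def op : FrobSystem k Aᵐᵒᵖ V where
  e i := MulOpposite.op (S.e i)
  idem :=
    { idem := fun i => congrArg MulOpposite.op (S.idem.idem i).eq
      ortho := fun i j hij => congrArg MulOpposite.op (S.idem.ortho hij.symm)
      complete := by rw [← Finset.op_sum, S.idem.complete, op_one] }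
  frob i := (S.frob i).op
  left i := (S.right i).op
  right i := (S.left i).op_right
  h i := S.exists_bound.choose - S.h i
  dir i j hij hh a := by
    have hi := S.exists_bound.choose_spec i
    have hj := S.exists_bound.choose_spec j
    apply unop_injective
    simpa [mul_assoc] using S.dir j i hij.symm (by omega) a.unop
  J := S.J.comap (opLinearEquiv k (M := A)).symm.toLinearMap
  mul_mem a x hx := S.mul_mem' a.unop x.unop hx
  mul_mem' a x hx := S.mul_mem a.unop x.unop hx
  nilp := by
    obtain ⟨m, hm⟩ := S.nilp
    refine ⟨m, ?_⟩
    rw [← Submodule.comap_unop_pow, hm, Submodule.comap_bot]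
    exact LinearEquiv.ker _
  loc i x hx := by
    obtain ⟨c, hc⟩ := S.loc i x.unop ⟨congrArg unop hx.2, congrArg unop hx.1⟩
    exact ⟨c, hc⟩

theorem exists_hasInjDimLE_self (S : FrobSystem k A V) [Module.Finite k A] :
    ∃ n, HasInjDimLE A n (ModuleCat.of A A) :=
  (S.exists_hasInjDimLE_iff A).2 S.left

theorem exists_hasInjDimLE_op_self (S : FrobSystem k A V) [Module.Finite k A] :
    ∃ n, HasInjDimLE Aᵐᵒᵖ n (ModuleCat.of Aᵐᵒᵖ Aᵐᵒᵖ) :=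
  S.op.exists_hasInjDimLE_self

end FrobSystem

/-! ## Freeness over corner rings -/

section

variable {k : Type} [Field k] {A : Type} [Ring A] [Algebra k A] (ε : IdemElem A)
variable {M : Type} [AddCommGroup M] [Module k M] [Module A M] [IsScalarTower k A M]

/-- An element of the corner ring. -/
def Corner.of {ε : IdemElem A} (x : A) (h : ε.e * x = x ∧ x * ε.e = x) : Corner ε := ⟨x, h⟩

/-- An element of the corner of a module. -/
def CornerMod.of {ε : IdemElem A} (m : M) (h : ε.e • m = m) : CornerMod ε M := ⟨m, h⟩

/-- The inclusion of `eM` into `M`. -/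
def CornerMod.valHom (M : Type) [AddCommGroup M] [Module A M] : CornerMod ε M →+ M :=
  AddMonoidHom.mk' Subtype.val fun _ _ => rfl

theorem CornerMod.val_sum {ι : Type} (s : Finset ι) (f : ι → CornerMod ε M) :
    (∑ i ∈ s, f i).1 = ∑ i ∈ s, (f i).1 :=
  map_sum (CornerMod.valHom ε M) f s

theorem Frame.free {M : Type} [AddCommGroup M] [Module k M] [Module A M] (f : Frame k ε.e M) : Module.Free (Corner ε) (CornerMod ε M) := by
  let E : CornerMod ε M ≃ₗ[Corner ε] (f.T → Corner ε) :=
    { toFun := fun m t => Corner.of (f.coord t m.1) (f.coord_mem t m.1)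
      map_add' := fun m n => funext fun t => Subtype.ext ((f.coord t).map_add m.1 n.1)
      map_smul' := fun c m => by
        ext t
        exact Subtype.ext (f.coord_smul (a := c.1) c.2 t m.1)
      invFun := fun a => CornerMod.of (∑ t, (a t).1 • f.x t) <| by
        rw [Finset.smul_sum]
        exact Finset.sum_congr rfl fun t _ => by rw [smul_smul, (a t).2.1]
      left_inv := fun m => Subtype.ext ((f.sum_coord m.1).trans m.2)
      right_inv := fun a => funext fun t =>
        Subtype.ext (f.coord_sum (fun t => (a t).1) (fun t => (a t).2) t) }
  exact Module.Free.of_equiv E.symm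

theorem CornerMod.finite [Module.Finite k M] : Module.Finite (Corner ε) (CornerMod ε M) := by
  let B := Module.finBasis k (fixSub k ε.e M)
  refine ⟨Submodule.fg_def.2 ⟨Set.range fun i => CornerMod.of (B i : M) (B i).2,
    Set.finite_range _, eq_top_iff.2 fun m _ => ?_⟩⟩
  have : m = ∑ i, Corner.of (ε := ε) (B.repr ⟨m.1, m.2⟩ i • ε.e) ⟨by rw [mul_smul_comm, ε.idem],
      by rw [smul_mul_assoc, ε.idem]⟩ • CornerMod.of (ε := ε) (B i : M) (B i).2 := by
    apply Subtype.ext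
    rw [CornerMod.val_sum]
    have h := congrArg Subtype.val (B.sum_repr ⟨m.1, m.2⟩)
    simp only [AddSubmonoidClass.coe_finsetSum, Submodule.coe_smul] at h
    conv_lhs => rw [← h]
    refine Finset.sum_congr rfl fun i _ => ?_
    change _ = (_ • ε.e) • (B i : M)
    rw [smul_assoc, (B i).2]
  rw [this]
  exact Submodule.sum_mem _ fun i _ => Submodule.smul_mem _ _ (Submodule.subset_span ⟨i, rfl⟩)

theorem Frame.nonempty_of_free [Module.Finite k M] (h : Module.Free (Corner ε) (CornerMod ε M)) :
    Nonempty (Frame k ε.e M) := by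
  rcases subsingleton_or_nontrivial (Corner ε) with hs | hs
  · have he : ε.e = 0 := congrArg Subtype.val (Subsingleton.elim (1 : Corner ε) 0)
    refine Frame.nonempty_of_bijective ε.idem (T := Empty) (fun t => t.elim) (fun t => t.elim)
      (fun m hm => ⟨fun t => t.elim, fun t => t.elim, ?_⟩) fun _ _ _ t => t.elim
    rw [← hm, he, zero_smul]
    rfl
  · have := CornerMod.finite (k := k) ε (M := M)
    let b := Module.Free.chooseBasis (Corner ε) (CornerMod ε M)
    refine Frame.nonempty_of_bijective ε.idem (fun t => (b t).1) (fun t => (b t).2)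
      (fun m hm => ⟨fun t => (b.repr ⟨m, hm⟩ t).1, fun t => (b.repr ⟨m, hm⟩ t).2, ?_⟩)
      fun a ha h0 t => ?_
    · have := congrArg Subtype.val (b.sum_repr ⟨m, hm⟩)
      rwa [CornerMod.val_sum] at this
    · have h1 : ∑ t, Corner.of (a t) (ha t) • b t = 0 := by
        apply Subtype.ext
        rw [CornerMod.val_sum]
        exact h0
      exact congrArg Subtype.val (Fintype.linearIndependent_iff.1 b.linearIndependent _ h1 t)

end

theorem FrobSystem.higman_iff_free {k A V : Type} [Field k] [Ring A] [Algebra k A] [Fintype V]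
    (S : FrobSystem k A V) (M : Type) [AddCommGroup M] [Module k M] [Module A M]
    [IsScalarTower k A M] [Module.Finite k M] (i : V) (ε : IdemElem A) (hε : ε.e = S.e i) :
    (S.frob i).Higman M ↔ Module.Free (Corner ε) (CornerMod ε M) := by
  constructor
  · intro h
    obtain ⟨f⟩ := S.higman_frame h
    rw [← hε] at f
    exact f.free
  · intro h
    obtain ⟨f⟩ := Frame.nonempty_of_free (k := k) ε h
    rw [hε] at f
    exact f.higman _

end

section

/-! ## Matrix representations adapted to a system of idempotents -/

/-- The index set of a basis adapted to a dimension vector. -/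
abbrev VIx {V : Type} (d : V → ℕ) : Type := (i : V) × Fin (d i)

open Matrix

section

variable {k A V : Type} [Field k] [Ring A] [Algebra k A] [Fintype V] [DecidableEq V]

/-- Matrix representations of `A` of dimension vector `d` with respect to the system `e`. -/
def VRep (k : Type) {A V : Type} [Field k] [Ring A] [Algebra k A] [Fintype V] [DecidableEq V]
    (e : V → A) (d : V → ℕ) : Type :=
  {ρ : A →ₐ[k] Matrix (VIx d) (VIx d) k //
    ∀ i, ρ (e i) = Matrix.diagonal fun u => if u.1 = i then 1 else 0}

/-- The regular functions on the space of representations. -/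
def regular (k : Type) {A V : Type} [Field k] [Ring A] [Algebra k A] [Fintype V] [DecidableEq V]
    (e : V → A) (d : V → ℕ) : Subalgebra k (VRep k e d → k) :=
  Algebra.adjoin k {F | ∃ a u v, F = fun ρ => ρ.1 a u v}

/-- Any two nonvanishing loci of regular functions meet. -/
def RepIrreducible (k : Type) {A V : Type} [Field k] [Ring A] [Algebra k A] [Fintype V]
    [DecidableEq V] (e : V → A) : Prop :=
  ∀ d : V → ℕ, ∀ F₁ ∈ regular k e d, ∀ F₂ ∈ regular k e d,
    (∃ ρ, F₁ ρ ≠ 0) → (∃ ρ, F₂ ρ ≠ 0) → ∃ ρ, F₁ ρ ≠ 0 ∧ F₂ ρ ≠ 0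

/-- The representation is generated by finitely many vectors with coefficients in prescribed
subspaces of `A`. -/
def Generated {n T : Type} [Fintype n] [DecidableEq n] [Fintype T]
    (ρ : A →ₐ[k] Matrix n n k) (S : T → Submodule k A) : Prop :=
  ∃ v : T → (n → k), ∀ w, ∃ a : T → A, (∀ τ, a τ ∈ S τ) ∧ ∑ τ, ρ (a τ) *ᵥ v τ = w

variable {e : V → A} {d : V → ℕ}

theorem entry_mem_regular (a : A) (u v : VIx d) :
    (fun ρ : VRep k e d => ρ.1 a u v) ∈ regular k e d :=
  Algebra.subset_adjoin ⟨a, u, v, rfl⟩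

theorem mulVec_mem_regular (a : A) (v : VIx d → k) (u : VIx d) :
    (fun ρ : VRep k e d => (ρ.1 a *ᵥ v) u) ∈ regular k e d := by
  have : (fun ρ : VRep k e d => (ρ.1 a *ᵥ v) u) =
      ∑ w, v w • (fun ρ : VRep k e d => ρ.1 a u w) := by
    ext ρ
    simp [Matrix.mulVec, dotProduct, Finset.sum_apply, mul_comm]
  rw [this]
  exact Subalgebra.sum_mem _ fun w _ => Subalgebra.smul_mem _ (entry_mem_regular a u w) _

theorem det_mem_regular (X : VIx d → VIx d → VRep k e d → k)
    (hX : ∀ u v, X u v ∈ regular k e d) :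
    (fun ρ => Matrix.det (Matrix.of fun u v => X u v ρ)) ∈ regular k e d := by
  have : (fun ρ => Matrix.det (Matrix.of fun u v => X u v ρ)) =
      ∑ σ : Equiv.Perm (VIx d), (((Equiv.Perm.sign σ : ℤˣ) : ℤ) : k) • ∏ u, X (σ u) u := by
    ext ρ
    simp [Matrix.det_apply', Finset.sum_apply, Finset.prod_apply]
  rw [this]
  exact Subalgebra.sum_mem _ fun σ _ =>
    Subalgebra.smul_mem _ (Subalgebra.prod_mem _ fun u _ => hX _ _) _

/-- Being generated by vectors with prescribed coefficient spaces is an open condition. -/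
theorem Generated.exists_regular {T : Type} [Fintype T] {S : T → Submodule k A}
    {ρ₁ : VRep k e d} (h : Generated ρ₁.1 S) :
    ∃ F ∈ regular k e d, F ρ₁ ≠ 0 ∧ ∀ ρ : VRep k e d, F ρ ≠ 0 → Generated ρ.1 S := by
  obtain ⟨v, hv⟩ := h
  choose a ha hav using fun u : VIx d => hv (Pi.single u 1)
  let X : VIx d → VIx d → VRep k e d → k := fun w u ρ => (∑ τ, ρ.1 (a u τ) *ᵥ v τ) w
  refine ⟨fun ρ => Matrix.det (Matrix.of fun w u => X w u ρ), det_mem_regular X fun w u => ?_, ?_,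
    fun ρ hρ => ⟨v, fun w => ?_⟩⟩
  · have : X w u = ∑ τ, fun ρ : VRep k e d => (ρ.1 (a u τ) *ᵥ v τ) w := by
      ext ρ
      simp [X, Finset.sum_apply]
    rw [this]
    exact Subalgebra.sum_mem _ fun τ _ => mulVec_mem_regular _ _ _
  · have : (Matrix.of fun w u => X w u ρ₁) = 1 := by
      ext w u
      simp only [X, hav, Matrix.of_apply, Matrix.one_apply, Pi.single_apply]
    simp [this]
  · set D : Matrix (VIx d) (VIx d) k := Matrix.of fun w u => X w u ρ with hD
    have hunit : IsUnit D.det := isUnit_iff_ne_zero.2 hρ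
    let c := D⁻¹ *ᵥ w
    have hc : D *ᵥ c = w := by
      simp only [c, Matrix.mulVec_mulVec, Matrix.mul_nonsing_inv D hunit, Matrix.one_mulVec]
    refine ⟨fun τ => ∑ u, c u • a u τ, fun τ => Submodule.sum_mem _ fun u _ =>
      Submodule.smul_mem _ _ (ha u τ), ?_⟩
    rw [← hc]
    ext x
    simp only [map_sum, map_smul, Finset.sum_apply, Matrix.sum_mulVec, Matrix.smul_mulVec,
      Pi.smul_apply, smul_eq_mul]
    rw [Finset.sum_comm]
    simp only [Matrix.mulVec, dotProduct, hD, Matrix.of_apply, X, Finset.sum_apply]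
    refine Finset.sum_congr rfl fun u _ => ?_
    rw [← Finset.mul_sum, mul_comm]

namespace VRep

open MulOpposite

/-- The transposed representation of the opposite algebra. -/
def op (ρ : VRep k e d) : VRep k (fun i => MulOpposite.op (e i)) d :=
  ⟨((Matrix.transposeAlgEquiv (VIx d) k k).symm : _ →ₐ[k] _).comp (AlgHom.op ρ.1), fun i => by
    change (ρ.1 (e i))ᵀ = _
    rw [ρ.2, Matrix.diagonal_transpose]⟩

theorem op_apply (ρ : VRep k e d) (a : Aᵐᵒᵖ) : ρ.op.1 a = (ρ.1 a.unop)ᵀ := rfl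

/-- The transposed representation of a representation of the opposite algebra. -/
def unop (ρ : VRep k (fun i => MulOpposite.op (e i)) d) : VRep k e d :=
  ⟨AlgHom.unop (((Matrix.transposeAlgEquiv (VIx d) k k) : _ →ₐ[k] _).comp ρ.1), fun i => by
    change (ρ.1 (MulOpposite.op (e i)))ᵀ = _
    rw [ρ.2, Matrix.diagonal_transpose]⟩

theorem op_unop (ρ : VRep k (fun i => MulOpposite.op (e i)) d) : ρ.unop.op = ρ := by
  apply Subtype.ext
  ext a
  rfl

end VRep

theorem regular_comp_op {F : VRep k (fun i => MulOpposite.op (e i)) d → k}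
    (hF : F ∈ regular k (fun i => MulOpposite.op (e i)) d) :
    (fun ρ : VRep k e d => F ρ.op) ∈ regular k e d := by
  induction hF using Algebra.adjoin_induction with
  | mem x hx =>
    obtain ⟨a, u, v, rfl⟩ := hx
    exact entry_mem_regular a.unop v u
  | algebraMap r => exact Subalgebra.algebraMap_mem _ r
  | add x y _ _ hx hy => exact Subalgebra.add_mem _ hx hy
  | mul x y _ _ hx hy => exact Subalgebra.mul_mem _ hx hy

theorem RepIrreducible.op (h : RepIrreducible k e) :
    RepIrreducible k fun i => MulOpposite.op (e i) := by
  rintro d F₁ h₁ F₂ h₂ ⟨ρ₁, hρ₁⟩ ⟨ρ₂, hρ₂⟩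
  obtain ⟨ρ, hρ⟩ := h d _ (regular_comp_op h₁) _ (regular_comp_op h₂)
    ⟨ρ₁.unop, by rwa [VRep.op_unop]⟩ ⟨ρ₂.unop, by rwa [VRep.op_unop]⟩
  exact ⟨ρ.op, hρ⟩

theorem RepIrreducible.generated (h : RepIrreducible k e) {T₁ T₂ : Type} [Fintype T₁] [Fintype T₂]
    {S₁ : T₁ → Submodule k A} {S₂ : T₂ → Submodule k A} {ρ₁ ρ₂ : VRep k e d}
    (h₁ : Generated ρ₁.1 S₁) (h₂ : Generated ρ₂.1 S₂) :
    ∃ ρ : VRep k e d, Generated ρ.1 S₁ ∧ Generated ρ.1 S₂ := by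
  obtain ⟨F₁, hF₁, hρ₁, H₁⟩ := h₁.exists_regular
  obtain ⟨F₂, hF₂, hρ₂, H₂⟩ := h₂.exists_regular
  obtain ⟨ρ, h₁, h₂⟩ := h d F₁ hF₁ F₂ hF₂ ⟨ρ₁, hρ₁⟩ ⟨ρ₂, hρ₂⟩
  exact ⟨ρ, H₁ ρ h₁, H₂ ρ h₂⟩

theorem RepIrreducible.generated_op (h : RepIrreducible k e) {T₁ T₂ : Type} [Fintype T₁]
    [Fintype T₂] {S₁ : T₁ → Submodule k A} {S₂ : T₂ → Submodule k Aᵐᵒᵖ} {ρ₁ : VRep k e d}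
    {ρ₂ : VRep k (fun i => MulOpposite.op (e i)) d}
    (h₁ : Generated ρ₁.1 S₁) (h₂ : Generated ρ₂.1 S₂) :
    ∃ ρ : VRep k e d, Generated ρ.1 S₁ ∧ Generated ρ.op.1 S₂ := by
  obtain ⟨F₁, hF₁, hρ₁, H₁⟩ := h₁.exists_regular
  obtain ⟨F₂, hF₂, hρ₂, H₂⟩ := h₂.exists_regular
  obtain ⟨ρ, h₁, h₂⟩ := h d F₁ hF₁ _ (regular_comp_op hF₂) ⟨ρ₁, hρ₁⟩
    ⟨ρ₂.unop, by rwa [VRep.op_unop]⟩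
  exact ⟨ρ, H₁ ρ h₁, H₂ ρ.op h₂⟩

/-- Every finite-dimensional module is afforded by a matrix representation. -/
theorem exists_vrep (he : CompleteOrthogonalIdempotents e) (N : Type) [AddCommGroup N] [Module k N]
    [Module A N] [IsScalarTower k A N] [Module.Finite k N]
    (hd : ∀ i, Module.finrank k (fixSub k (e i) N) = d i) :
    ∃ (ρ : VRep k e d) (E : N ≃ₗ[k] (VIx d → k)), ∀ a n, E (a • n) = ρ.1 a *ᵥ E n := by
  have B := fun i => Module.finBasisOfFinrankEq k (fixSub k (e i) N) (hd i)
  have hee : ∀ i j (n : N), e i • e j • n = if i = j then e j • n else 0 := fun i j n => by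
    split_ifs with h
    · rw [h, smul_smul, (he.idem j).eq]
    · rw [smul_smul, he.ortho h, zero_smul]
  let ι : ∀ i, N →ₗ[k] fixSub k (e i) N := fun i =>
    (Algebra.lsmul k k N (e i)).codRestrict _ fun n => by
      rw [mem_fixSub]; simp [smul_smul, (he.idem i).eq]
  have hι : ∀ i n, (ι i n : N) = e i • n := fun _ _ => rfl
  have hιfix : ∀ i j (n : fixSub k (e j) N), (ι i n : N) = if i = j then (n : N) else 0 :=
    fun i j n => by
      rw [hι, ← (mem_fixSub.1 n.2), hee]
  have hιsum : ∀ (x : ∀ j, fixSub k (e j) N) i, ι i (∑ j, (x j : N)) = x i := fun x i => by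
    apply Subtype.ext
    rw [map_sum, AddSubmonoidClass.coe_finsetSum]
    simp only [hιfix]
    rw [Finset.sum_ite_eq, if_pos (Finset.mem_univ i)]
  let E : N ≃ₗ[k] (VIx d → k) :=
    { toFun := fun n u => (B u.1).equivFun (ι u.1 n) u.2
      map_add' := fun m n => by ext u; simp
      map_smul' := fun c n => by ext u; simp
      invFun := fun v => ∑ i, ((B i).equivFun.symm fun s => v ⟨i, s⟩ : fixSub k (e i) N)
      left_inv := fun n => by
        have : ∀ i, (((B i).equivFun.symm fun s => (B i).equivFun (ι i n) s :
            fixSub k (e i) N) : N) = e i • n := fun i => by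
          rw [← hι]
          exact congrArg Subtype.val ((B i).equivFun.symm_apply_apply (ι i n))
        simp only [this]
        rw [← Finset.sum_smul, he.complete, one_smul]
      right_inv := fun v => by
        ext ⟨i, s⟩
        change (B i).equivFun (ι i (∑ j, ((B j).equivFun.symm fun s => v ⟨j, s⟩ :
          fixSub k (e j) N))) s = _
        rw [hιsum fun j => (B j).equivFun.symm fun s => v ⟨j, s⟩, LinearEquiv.apply_symm_apply] }
  have hE : ∀ n u, E n u = (B u.1).equivFun (ι u.1 n) u.2 := fun _ _ => rfl
  let ρ : A →ₐ[k] Matrix (VIx d) (VIx d) k :=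
    ((LinearMap.toMatrixAlgEquiv' : _ ≃ₐ[k] Matrix (VIx d) (VIx d) k) : _ →ₐ[k] _).comp
      ((E.conjAlgEquiv k : _ ≃ₐ[k] Module.End k (VIx d → k)).toAlgHom.comp (Algebra.lsmul k k N))
  have hρ : ∀ a v, ρ a *ᵥ v = E (a • E.symm v) := fun a v =>
    LinearMap.toMatrix'_mulVec (E.conjAlgEquiv k (Algebra.lsmul k k N a)) v
  refine ⟨⟨ρ, fun i => ?_⟩, E, fun a n => by rw [hρ, LinearEquiv.symm_apply_apply]⟩
  apply Matrix.ext_of_mulVec_single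
  intro w
  rw [hρ]
  ext u
  rw [hE, Matrix.mulVec_diagonal]
  have : ι u.1 (e i • E.symm (Pi.single w 1)) =
      if u.1 = i then ι u.1 (E.symm (Pi.single w 1)) else 0 := by
    apply Subtype.ext
    rw [hι, hee]
    split_ifs with h
    · rw [hι, h]
    · rfl
  rw [this]
  split_ifs with h
  · rw [one_mul, ← hE, LinearEquiv.apply_symm_apply]
  · simp

end

end

section

open Matrix

/-! ## Frobenius corners from irreducibility -/

section

variable {k A V : Type} [Field k] [Ring A] [Algebra k A]

/-- Products leaving a corner through another idempotent and returning to it vanish. -/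
def CornerClosed (e : V → A) : Prop :=
  ∀ i j, i ≠ j → ∀ a b, e i * a * e j * b * e i = 0

theorem CornerClosed.op {e : V → A} (h : CornerClosed e) :
    CornerClosed fun i => MulOpposite.op (e i) := fun i j hij a b => by
  apply MulOpposite.unop_injective
  simpa [mul_assoc] using h i j hij b.unop a.unop

theorem CompleteOrthogonalIdempotents.op [Fintype V] {e : V → A}
    (h : CompleteOrthogonalIdempotents e) :
    CompleteOrthogonalIdempotents fun i => MulOpposite.op (e i) :=
  { idem := fun i => congrArg MulOpposite.op (h.idem i).eq
    ortho := fun i j hij => congrArg MulOpposite.op (h.ortho hij.symm)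
    complete := by rw [← Finset.op_sum, h.complete, MulOpposite.op_one] }

theorem CornerClosed.mul [Fintype V] {e : V → A} (hc : CornerClosed e)
    (he : CompleteOrthogonalIdempotents e) (i : V) (a b : A) :
    e i * (a * b) * e i = e i * a * (e i * b * e i) := by
  have : e i * (a * b) * e i = ∑ j, e i * a * e j * b * e i := by
    rw [← Finset.sum_mul, ← Finset.sum_mul, ← Finset.mul_sum, he.complete, mul_one, mul_assoc _ a]
  rw [this, Finset.sum_eq_single i (fun j _ hj => hc i j hj.symm a b) (by simp)]
  simp only [mul_assoc]

/-- The left ideal of elements with vanishing compression to a corner. -/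
def cornerIdeal [Fintype V] {e : V → A} (hc : CornerClosed e)
    (he : CompleteOrthogonalIdempotents e) (i : V) : Submodule A A where
  carrier := {a | e i * a * e i = 0}
  add_mem' := fun {a b} (ha : _ = _) (hb : _ = _) => by
    change e i * (a + b) * e i = 0
    rw [mul_add, add_mul, ha, hb, add_zero]
  zero_mem' := by simp
  smul_mem' := fun c {a} (ha : _ = _) => by
    change e i * (c * a) * e i = 0
    rw [hc.mul he, ha, mul_zero]

theorem mem_cornerIdeal [Fintype V] {e : V → A} {hc : CornerClosed e}
    {he : CompleteOrthogonalIdempotents e} {i : V} {a : A} :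
    a ∈ cornerIdeal hc he i ↔ e i * a * e i = 0 := Iff.rfl

theorem finrank_fixSub_cornerIdeal [Fintype V] [DecidableEq V] {e : V → A} (hc : CornerClosed e)
    (he : CompleteOrthogonalIdempotents e) (i j : V) :
    Module.finrank k (fixSub k (e j) (A ⧸ cornerIdeal hc he i)) =
      if j = i then Module.finrank k (cornerSub k (e i)) else 0 := by
  split_ifs with h
  · subst h
    let f : cornerSub k (e j) →ₗ[k] fixSub k (e j) (A ⧸ cornerIdeal hc he j) :=
      LinearMap.codRestrict _ (((cornerIdeal hc he j).mkQ.restrictScalars k) ∘ₗ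
        (cornerSub k (e j)).subtype) fun x => by
          rw [mem_fixSub]
          change e j • (cornerIdeal hc he j).mkQ x.1 = (cornerIdeal hc he j).mkQ x.1
          rw [← map_smul, smul_eq_mul, x.2.1]
    have hf : ∀ x, (f x : A ⧸ cornerIdeal hc he j) = (cornerIdeal hc he j).mkQ x.1 := fun _ => rfl
    refine (LinearEquiv.finrank_eq (LinearEquiv.ofBijective f ⟨?_, ?_⟩)).symm
    · rw [← LinearMap.ker_eq_bot, LinearMap.ker_eq_bot']
      intro x hx
      have h := hf x
      rw [hx, eq_comm] at h
      replace h := (Submodule.Quotient.mk_eq_zero _).1 h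
      rw [mem_cornerIdeal, x.2.1, x.2.2] at h
      exact Subtype.ext h
    · rintro ⟨y, hy⟩
      obtain ⟨a, rfl⟩ := Submodule.mkQ_surjective _ y
      refine ⟨⟨e j * a * e j, mul_mem_cornerSub (he.idem j).eq a⟩, Subtype.ext ?_⟩
      rw [hf, ← sub_eq_zero, ← map_sub]
      refine (Submodule.Quotient.mk_eq_zero _).2 ?_
      rw [mem_cornerIdeal, mul_sub, sub_mul, ← mul_assoc, ← mul_assoc, (he.idem j).eq,
        mul_assoc _ (e j), (he.idem j).eq, sub_self]
  · have : fixSub k (e j) (A ⧸ cornerIdeal hc he i) = ⊥ := by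
      rw [eq_bot_iff]
      intro y hy
      obtain ⟨a, rfl⟩ := Submodule.mkQ_surjective _ y
      rw [← mem_fixSub.1 hy, ← map_smul]
      refine (Submodule.Quotient.mk_eq_zero _).2 ?_
      rw [mem_cornerIdeal, smul_eq_mul, ← mul_assoc, he.ortho (Ne.symm h), zero_mul, zero_mul]
    rw [this, finrank_bot]

theorem finrank_fixSub_pi [Module.Finite k A] (f : A) {T : Type} [Fintype T] (N : T → Type)
    [∀ τ, AddCommGroup (N τ)]
    [∀ τ, Module k (N τ)] [∀ τ, Module A (N τ)] [∀ τ, IsScalarTower k A (N τ)]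
    [∀ τ, Module.Finite k (N τ)] :
    Module.finrank k (fixSub k f (∀ τ, N τ)) = ∑ τ, Module.finrank k (fixSub k f (N τ)) := by
  rw [← Module.finrank_pi_fintype k]
  exact LinearEquiv.finrank_eq
    { toFun := fun x τ => ⟨x.1 τ, congrFun x.2 τ⟩
      map_add' := fun _ _ => rfl
      map_smul' := fun _ _ => rfl
      invFun := fun x => ⟨fun τ => x τ, funext fun τ => (x τ).2⟩
      left_inv := fun _ => rfl
      right_inv := fun _ => rfl }

/-- A nondegenerate form on a corner algebra determines a Frobenius structure. -/
theorem FrobCorner.nonempty_of_form [Module.Finite k A] {e : A} (he : e * e = e) (l : A →ₗ[k] k)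
    (hl : ∀ a ∈ cornerSub k e, (∀ x ∈ cornerSub k e, l (x * a) = 0) → a = 0) :
    Nonempty (FrobCorner k e) := by
  let X := cornerSub k e
  let Φ : X →ₗ[k] Module.Dual k X :=
    LinearMap.mk₂ k (fun a x : X => l (x.1 * a.1)) (fun a b x => by simp [mul_add])
      (fun c a x => by simp) (fun a x y => by simp [add_mul]) (fun c a x => by simp)
  have hΦ : ∀ a x, Φ a x = l (x.1 * a.1) := fun _ _ => rfl
  have hinj : Function.Injective Φ := by
    rw [← LinearMap.ker_eq_bot, LinearMap.ker_eq_bot']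
    exact fun a ha => Subtype.ext (hl a.1 a.2 fun x hx => LinearMap.congr_fun ha ⟨x, hx⟩)
  let E := LinearEquiv.ofInjectiveOfFinrankEq Φ hinj Subspace.dual_finrank_eq.symm
  have hE : ∀ a, E a = Φ a := fun _ => rfl
  let b' := Module.finBasis k X
  let b : Fin (Module.finrank k X) → X := fun s => E.symm (b'.coord s)
  have hb : ∀ s (x : X), l (x.1 * (b s).1) = b'.repr x s := fun s x => by
    rw [← hΦ, ← hE, LinearEquiv.apply_symm_apply, Module.Basis.coord_apply]
  refine ⟨{
    idem := he
    n := Module.finrank k X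
    b := fun s => b s
    b' := fun s => b' s
    form := l
    left_b := fun s => (b s).2.1
    right_b := fun s => (b s).2.2
    left_b' := fun s => (b' s).2.1
    right_b' := fun s => (b' s).2.2
    sum_left := fun x h₁ h₂ => ?_
    sum_right := fun x h₁ h₂ => ?_ }⟩
  · have : ∑ s, l ((b' s).1 * x) • b s = ⟨x, h₁, h₂⟩ := by
      apply hinj
      refine b'.ext fun t => ?_
      rw [map_sum, LinearMap.sum_apply, hΦ, Finset.sum_eq_single t]
      · rw [map_smul, LinearMap.smul_apply, hΦ, hb]; simp
      · intro s _ hs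
        rw [map_smul, LinearMap.smul_apply, hΦ, hb]; simp [hs.symm]
      · simp
    simpa using congrArg Subtype.val this
  · have := congrArg Subtype.val (b'.sum_repr ⟨x, h₁, h₂⟩)
    simp only [← hb] at this
    simpa using this

variable [Fintype V] [DecidableEq V] {e : V → A} {d : V → ℕ}

theorem exists_generated (he : CompleteOrthogonalIdempotents e) (N : Type) [AddCommGroup N]
    [Module k N] [Module A N] [IsScalarTower k A N] [Module.Finite k N]
    (hd : ∀ i, Module.finrank k (fixSub k (e i) N) = d i) {T : Type} [Fintype T]
    (S : T → Submodule k A) (x : T → N)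
    (hx : ∀ n, ∃ a : T → A, (∀ τ, a τ ∈ S τ) ∧ ∑ τ, a τ • x τ = n) :
    ∃ ρ : VRep k e d, Generated ρ.1 S := by
  obtain ⟨ρ, E, h⟩ := exists_vrep he N hd
  refine ⟨ρ, fun τ => E (x τ), fun w => ?_⟩
  obtain ⟨a, ha, haw⟩ := hx (E.symm w)
  refine ⟨a, ha, ?_⟩
  simp only [← h]
  rw [← map_sum, haw, LinearEquiv.apply_symm_apply]

variable [Module.Finite k A]

theorem exists_generated_corner (hc : CornerClosed e) (he : CompleteOrthogonalIdempotents e) (i : V)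
    (hd : ∀ j, (if j = i then Module.finrank k (cornerSub k (e i)) else 0) = d j) :
    ∃ ρ : VRep k e d, Generated ρ.1 fun _ : Unit => ⊤ := by
  have := FrobSystem.finite_quotient (k := k) (cornerIdeal hc he i)
  refine exists_generated he (A ⧸ cornerIdeal hc he i)
    (fun j => (finrank_fixSub_cornerIdeal hc he i j).trans (hd j)) _
    (fun _ => (cornerIdeal hc he i).mkQ 1) fun n => ?_
  obtain ⟨a, rfl⟩ := Submodule.mkQ_surjective _ n
  refine ⟨fun _ => a, fun _ => trivial, ?_⟩
  simp [← Submodule.Quotient.mk_smul]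

/-- The corners are Frobenius algebras. -/
theorem RepIrreducible.nonempty_frobCorner (h : RepIrreducible k e) (hc : CornerClosed e)
    (he : CompleteOrthogonalIdempotents e) (i : V) : Nonempty (FrobCorner k (e i)) := by
  let d : V → ℕ := fun j => if j = i then Module.finrank k (cornerSub k (e i)) else 0
  have hop : Module.finrank k (cornerSub k (MulOpposite.op (e i))) =
      Module.finrank k (cornerSub k (e i)) := LinearEquiv.finrank_eq
    { toFun := fun x => ⟨x.1.unop, congrArg MulOpposite.unop x.2.2,
        congrArg MulOpposite.unop x.2.1⟩
      map_add' := fun _ _ => rfl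
      map_smul' := fun _ _ => rfl
      invFun := fun x => ⟨MulOpposite.op x.1, congrArg MulOpposite.op x.2.2,
        congrArg MulOpposite.op x.2.1⟩
      left_inv := fun _ => rfl
      right_inv := fun _ => rfl }
  obtain ⟨ρ₁, h₁⟩ := exists_generated_corner (d := d) hc he i fun _ => rfl
  obtain ⟨ρ₂, h₂⟩ := exists_generated_corner (d := d) hc.op he.op i fun j => by rw [hop]
  obtain ⟨ρ, ⟨v, hv⟩, ⟨f, hf⟩⟩ := h.generated_op h₁ h₂
  have hρe : ρ.1 (e i) = 1 := by
    rw [ρ.2, ← Matrix.diagonal_one]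
    congr 1
    ext ⟨j, s⟩
    by_cases hj : j = i
    · simp [hj]
    · have : d j = 0 := if_neg hj
      exact absurd s.2 (by omega)
  have hρ : ∀ a, ρ.1 (e i * a * e i) = ρ.1 a := fun a => by
    rw [map_mul, map_mul, hρe, one_mul, mul_one]
  let π : cornerSub k (e i) →ₗ[k] (VIx d → k) :=
    (Matrix.mulVecBilin k k).flip (v ()) ∘ₗ ρ.1.toLinearMap ∘ₗ (cornerSub k (e i)).subtype
  have hπ : ∀ x, π x = ρ.1 x.1 *ᵥ v () := fun _ => rfl
  have hcard : Module.finrank k (cornerSub k (e i)) = Module.finrank k (VIx d → k) := by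
    rw [Module.finrank_fintype_fun_eq_card, Fintype.card_sigma]
    simp [d]
  have hπs : Function.Surjective π := fun w => by
    obtain ⟨a, -, ha⟩ := hv w
    refine ⟨⟨e i * a () * e i, mul_mem_cornerSub (he.idem i).eq _⟩, ?_⟩
    rw [hπ, hρ]
    simpa using ha
  have hπi := (LinearMap.injective_iff_surjective_of_finrank_eq_finrank hcard).2 hπs
  let l : A →ₗ[k] k :=
    (dotProductBilin k k (f ())) ∘ₗ (Matrix.mulVecBilin k k).flip (v ()) ∘ₗ ρ.1.toLinearMap
  have hl : ∀ a, l a = f () ⬝ᵥ (ρ.1 a *ᵥ v ()) := fun _ => rfl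
  refine FrobCorner.nonempty_of_form (he.idem i).eq l fun a ha h0 => ?_
  have : π ⟨a, ha⟩ = 0 := by
    rw [hπ]
    refine (dotProduct_eq_zero_iff (v := ρ.1 a *ᵥ v ())).1 fun w => ?_
    obtain ⟨x, -, hx⟩ := hf w
    have h1 := h0 _ (mul_mem_cornerSub (he.idem i).eq (x ()).unop)
    rw [hl, map_mul, hρ, ← Matrix.mulVec_mulVec, Matrix.dotProduct_mulVec,
      ← Matrix.mulVec_transpose] at h1
    rw [← hx, dotProduct_comm]
    simpa [VRep.op_apply] using h1
  exact congrArg Subtype.val (hπi (this.trans (map_zero π).symm))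

end

end

section

open Matrix

/-! ## Higman's criterion for the regular module -/

theorem FrobCorner.RightHigman.of_op {k A : Type} [Field k] [Ring A] [Algebra k A] {e : A}
    {F : FrobCorner k e} (h : F.op.Higman Aᵐᵒᵖ) : F.RightHigman := by
  obtain ⟨θ, hθ⟩ := h
  refine ⟨(MulOpposite.opLinearEquiv k).symm.toLinearMap ∘ₗ θ ∘ₗ
    (MulOpposite.opLinearEquiv k).toLinearMap, fun x hx => ?_⟩
  have := congrArg MulOpposite.unop (hθ (MulOpposite.op x) (congrArg MulOpposite.op hx))
  rw [FrobCorner.tr_apply] at this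
  simp only [FrobCorner.op] at this
  simp at this ⊢
  exact this

section

variable {k A V : Type} [Field k] [Ring A] [Algebra k A] [Module.Finite k A]
  [Fintype V] [DecidableEq V] {e : V → A}

theorem finrank_fixSub_eq_zero {f : A} (hf : f * f = f)
    (h : Module.finrank k (cornerSub k f) = 0) : Module.finrank k (fixSub k f A) = 0 := by
  have h0 : f = 0 := by
    have := Submodule.finrank_eq_zero.1 h
    have hm : f ∈ cornerSub k f := ⟨hf, hf⟩
    rwa [this, Submodule.mem_bot] at hm
  rw [Submodule.finrank_eq_zero, eq_bot_iff]
  intro x hx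
  rw [← mem_fixSub.1 hx, h0, zero_smul]
  exact Submodule.zero_mem _

theorem RepIrreducible.exists_nonempty_frame (h : RepIrreducible k e) (hc : CornerClosed e)
    (he : CompleteOrthogonalIdempotents e) :
    ∃ r : ℕ, 0 < r ∧ ∀ i, Nonempty (Frame k (e i) (Fin r → A)) := by
  let c : V → ℕ := fun j => Module.finrank k (cornerSub k (e j))
  let D : V → ℕ := fun j => Module.finrank k (fixSub k (e j) A)
  let r : ℕ := ∏ j, if c j = 0 then 1 else c j
  have hr : 0 < r := Finset.prod_pos fun j _ => by split_ifs <;> omega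
  have hm : ∀ j, ∃ m, r * D j = m * c j := fun j => by
    by_cases hj : c j = 0
    · exact ⟨0, by rw [show D j = 0 from finrank_fixSub_eq_zero (he.idem j).eq hj]; simp⟩
    · have : c j ∣ r := by
        have := Finset.dvd_prod_of_mem (fun j => if c j = 0 then 1 else c j) (Finset.mem_univ j)
        simpa only [if_neg hj] using this
      obtain ⟨m, hm⟩ := this.mul_right (D j)
      exact ⟨m, by rw [hm, mul_comm]⟩
  choose m hm using hm
  refine ⟨r, hr, fun i => ?_⟩
  let d : V → ℕ := fun j => r * D j
  have hd : ∀ j, Module.finrank k (fixSub k (e j) (Fin r → A)) = d j := fun j => by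
    rw [finrank_fixSub_pi]
    simp [d, D]
  have := fun i => FrobSystem.finite_quotient (k := k) (cornerIdeal hc he i)
  obtain ⟨ρ₁, h₁⟩ := exists_generated he (Fin r → A) hd (fun _ : Fin r => ⊤)
    (fun τ => Pi.single τ 1) fun n => ⟨n, fun _ => trivial, by
      simp only [← Pi.single_smul, smul_eq_mul, mul_one]
      exact Finset.univ_sum_single n⟩
  obtain ⟨ρ₂, h₂⟩ := exists_generated (d := d) he
    (∀ τ : (j : V) × Fin (m j), A ⧸ cornerIdeal hc he τ.1) (fun j => by
      rw [finrank_fixSub_pi]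
      simp only [finrank_fixSub_cornerIdeal]
      rw [Fintype.sum_sigma, Finset.sum_eq_single j]
      · refine (Finset.sum_congr rfl fun _ _ => if_pos rfl).trans ?_
        change ∑ _ : Fin (m j), c j = d j
        rw [Finset.sum_const, Finset.card_univ, Fintype.card_fin]
        exact (hm j).symm
      · exact fun i _ hi => Finset.sum_eq_zero fun _ _ => if_neg hi.symm
      · simp)
    (fun τ => cornerSub k (e τ.1)) (fun τ => Pi.single τ ((cornerIdeal hc he τ.1).mkQ 1))
    fun n => by
      choose a ha using fun τ => Submodule.mkQ_surjective _ (n τ)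
      refine ⟨fun τ => e τ.1 * a τ * e τ.1, fun τ => mul_mem_cornerSub (he.idem τ.1).eq _, ?_⟩
      rw [← Finset.univ_sum_single n]
      refine Finset.sum_congr rfl fun τ _ => ?_
      rw [← Pi.single_smul, ← ha, ← map_smul, smul_eq_mul, mul_one]
      congr 1
      rw [← sub_eq_zero, ← map_sub]
      refine (Submodule.Quotient.mk_eq_zero _).2 ?_
      rw [mem_cornerIdeal, mul_sub, sub_mul, ← mul_assoc, ← mul_assoc, (he.idem _).eq,
        mul_assoc _ (e τ.1), (he.idem _).eq, sub_self]
  obtain ⟨ρ, ⟨v, hv⟩, ⟨w, hw⟩⟩ := h.generated h₁ h₂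
  let π : (Fin r → A) →ₗ[k] (VIx d → k) :=
    ∑ τ, (Matrix.mulVecBilin k k).flip (v τ) ∘ₗ ρ.1.toLinearMap ∘ₗ LinearMap.proj τ
  have hπ : ∀ x, π x = ∑ τ, ρ.1 (x τ) *ᵥ v τ := fun x => by
    simp [π]
  have hπs : Function.Surjective π := fun u => by
    obtain ⟨a, -, ha⟩ := hv u
    exact ⟨a, (hπ a).trans ha⟩
  obtain ⟨-, E, -⟩ := exists_vrep he (Fin r → A) hd
  have hπi := (LinearMap.injective_iff_surjective_of_finrank_eq_finrank E.finrank_eq).2 hπs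
  have hπa : ∀ a x, π (a • x) = ρ.1 a *ᵥ π x := fun a x => by
    rw [hπ, hπ, Matrix.mulVec_sum]
    simp
  choose w' hw' using fun τ => hπs (w τ)
  let x : Fin (m i) → Fin r → A := fun t => e i • w' ⟨i, t⟩
  have hx : ∀ t, e i • x t = x t := fun t => by rw [smul_smul, (he.idem i).eq]
  have hsurj : ∀ y : Fin r → A, e i • y = y →
      ∃ a : Fin (m i) → A, (∀ t, a t ∈ cornerSub k (e i)) ∧ ∑ t, a t • x t = y := fun y hy => by
    obtain ⟨a, ha, hay⟩ := hw (π y)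
    refine ⟨fun t => a ⟨i, t⟩, fun t => ha ⟨i, t⟩, ?_⟩
    have hy' : ∑ τ, a τ • w' τ = y := hπi (by
      rw [← hay, map_sum]
      exact Finset.sum_congr rfl fun τ _ => by rw [hπa, hw'])
    rw [← hy, ← hy', Finset.smul_sum, Fintype.sum_sigma, Finset.sum_eq_single i]
    · refine Finset.sum_congr rfl fun t _ => ?_
      rw [smul_smul, smul_smul, (ha ⟨i, t⟩).1, (ha ⟨i, t⟩).2]
    · intro j _ hj
      refine Finset.sum_eq_zero fun t _ => ?_
      rw [smul_smul, ← (ha ⟨j, t⟩).1, ← mul_assoc, he.ortho hj.symm, zero_mul, zero_smul]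
    · simp
  refine Frame.nonempty_of_bijective (he.idem i).eq x hx hsurj fun a ha h0 t => ?_
  let g : (Fin (m i) → cornerSub k (e i)) →ₗ[k] fixSub k (e i) (Fin r → A) :=
    LinearMap.codRestrict _ (∑ t, (LinearMap.toSpanSingleton A (Fin r → A) (x t)).restrictScalars k
      ∘ₗ (cornerSub k (e i)).subtype ∘ₗ LinearMap.proj t) fun a => by
        rw [mem_fixSub]
        simp only [LinearMap.sum_apply, LinearMap.comp_apply, LinearMap.proj_apply,
          Submodule.subtype_apply, LinearMap.restrictScalars_apply,
          LinearMap.toSpanSingleton_apply, Finset.smul_sum, smul_smul]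
        exact Finset.sum_congr rfl fun t _ => by rw [(a t).2.1]
  have hg : ∀ a, (g a : Fin r → A) = ∑ t, (a t).1 • x t := fun a => by
    simp [g]
  have hgs : Function.Surjective g := fun y => by
    obtain ⟨a, ha, hay⟩ := hsurj y.1 y.2
    exact ⟨fun t => ⟨a t, ha t⟩, Subtype.ext ((hg _).trans hay)⟩
  have hgi := (LinearMap.injective_iff_surjective_of_finrank_eq_finrank (by
    rw [Module.finrank_pi_fintype, hd]
    simpa [d] using (hm i).symm)).2 hgs
  have : (fun t => (⟨a t, ha t⟩ : cornerSub k (e i))) = 0 := hgi (by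
    rw [map_zero]
    exact Subtype.ext ((hg _).trans h0))
  exact congrArg Subtype.val (congrFun this t)

/-- The regular module satisfies Higman's criterion at every vertex. -/
theorem RepIrreducible.higman (h : RepIrreducible k e) (hc : CornerClosed e)
    (he : CompleteOrthogonalIdempotents e) {i : V} (F : FrobCorner k (e i)) : F.Higman A := by
  obtain ⟨r, hr, hf⟩ := h.exists_nonempty_frame hc he
  obtain ⟨f⟩ := hf i
  exact (f.higman F).of_retract (LinearMap.single A (fun _ : Fin r => A) ⟨0, hr⟩)
    (LinearMap.proj ⟨0, hr⟩) fun x => by simp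

theorem RepIrreducible.rightHigman (h : RepIrreducible k e) (hc : CornerClosed e)
    (he : CompleteOrthogonalIdempotents e) {i : V} (F : FrobCorner k (e i)) : F.RightHigman :=
  .of_op (h.op.higman hc.op he.op (i := i) F.op)

end

end

section

open Matrix

/-! ## Algebras presented by quivers with relations -/

section

variable {k : Type} [Field k] {Γ : FinQuiver}

theorem completeOrthogonalIdempotents_vertexElem :
    CompleteOrthogonalIdempotents (vertexElem k Γ) where
  idem i := vertexElem_mul_self k Γ i
  ortho i j hij := by
    change vertexElem k Γ i * vertexElem k Γ j = 0
    rw [vertexElem, vertexElem, ← map_mul, RingQuot.mkAlgHom_rel k (PathRel.orth i j hij), map_zero]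
  complete := by
    have := RingQuot.mkAlgHom_rel k (PathRel.sum_one (K := k) (Q := Γ))
    simpa [vertexElem] using this

theorem vertexElem_tgt_mul (a : Γ.A) :
    vertexElem k Γ (Γ.tgt a) * arrowElem k Γ a = arrowElem k Γ a := by
  rw [vertexElem, arrowElem, ← map_mul, RingQuot.mkAlgHom_rel k (PathRel.tgt_mul a)]

theorem mul_vertexElem_src (a : Γ.A) :
    arrowElem k Γ a * vertexElem k Γ (Γ.src a) = arrowElem k Γ a := by
  rw [vertexElem, arrowElem, ← map_mul, RingQuot.mkAlgHom_rel k (PathRel.mul_src a)]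

theorem pathAlgebra_induction {p : PathAlgebra k Γ → Prop} (hv : ∀ i, p (vertexElem k Γ i))
    (ha : ∀ a, p (arrowElem k Γ a)) (hc : ∀ c : k, p (algebraMap k _ c))
    (hadd : ∀ x y, p x → p y → p (x + y)) (hmul : ∀ x y, p x → p y → p (x * y)) (x) : p x := by
  obtain ⟨x, rfl⟩ := RingQuot.mkAlgHom_surjective k (PathRel k Γ) x
  induction x using FreeAlgebra.induction with
  | grade0 r => rw [AlgHom.commutes]; exact hc r
  | grade1 s => rcases s with i | a; exacts [hv i, ha a]
  | mul x y hx hy => rw [map_mul]; exact hmul _ _ hx hy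
  | add x y hx hy => rw [map_add]; exact hadd _ _ hx hy

/-- The diagonal projection onto the block of a vertex. -/
def blockIdem (k : Type) [Field k] {V : Type} [DecidableEq V] (d : V → ℕ) (i : V) :
    Matrix (VIx d) (VIx d) k :=
  Matrix.diagonal fun u => if u.1 = i then 1 else 0

variable {d : Γ.V → ℕ} {M : RepSpace k Γ d}

theorem blockIdem_mul (hM : BlockCompatible k Γ d M) (a : Γ.A) :
    blockIdem k d (Γ.tgt a) * M a = M a := by
  ext u v
  rw [blockIdem, Matrix.diagonal_mul]
  by_cases h : M a u v = 0
  · rw [h, mul_zero]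
  · rw [if_pos (hM a u v h).1, one_mul]

theorem mul_blockIdem (hM : BlockCompatible k Γ d M) (a : Γ.A) :
    M a * blockIdem k d (Γ.src a) = M a := by
  ext u v
  rw [blockIdem, Matrix.mul_diagonal]
  by_cases h : M a u v = 0
  · rw [h, zero_mul]
  · rw [if_pos (hM a u v h).2, mul_one]

/-- The matrix representation of the path algebra given by a quiver representation. -/
def pathRep (hM : BlockCompatible k Γ d M) : PathAlgebra k Γ →ₐ[k] Matrix (VIx d) (VIx d) k :=
  RingQuot.liftAlgHom k ⟨FreeAlgebra.lift k (Sum.elim (blockIdem k d) M), fun {x y} h => by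
    cases h with
    | idem i =>
      simp only [map_mul, FreeAlgebra.lift_ι_apply, Sum.elim_inl, blockIdem,
        Matrix.diagonal_mul_diagonal]
      congr 1
      ext u
      split_ifs <;> simp
    | orth i j hij =>
      simp only [map_mul, map_zero, FreeAlgebra.lift_ι_apply, Sum.elim_inl, blockIdem,
        Matrix.diagonal_mul_diagonal]
      rw [← Matrix.diagonal_zero]
      congr 1
      ext u
      by_cases h : u.1 = i
      · simp [h, hij]
      · simp [h]
    | sum_one =>
      simp only [map_sum, map_one, FreeAlgebra.lift_ι_apply, Sum.elim_inl]
      ext u v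
      rw [Matrix.sum_apply]
      simp only [blockIdem, Matrix.diagonal_apply, Matrix.one_apply]
      split_ifs <;> simp
    | tgt_mul a =>
      simp only [map_mul, FreeAlgebra.lift_ι_apply, Sum.elim_inl, Sum.elim_inr]
      exact blockIdem_mul hM a
    | mul_src a =>
      simp only [map_mul, FreeAlgebra.lift_ι_apply, Sum.elim_inl, Sum.elim_inr]
      exact mul_blockIdem hM a⟩

theorem pathRep_vertexElem (hM : BlockCompatible k Γ d M) (i : Γ.V) :
    pathRep hM (vertexElem k Γ i) = blockIdem k d i := by
  simp [pathRep, vertexElem]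

theorem pathRep_arrowElem (hM : BlockCompatible k Γ d M) (a : Γ.A) :
    pathRep hM (arrowElem k Γ a) = M a := by
  simp [pathRep, arrowElem]

theorem map_relElem (β : PathAlgebra k Γ →ₐ[k] Matrix (VIx d) (VIx d) k)
    (c : QPath Γ →₀ k) :
    β (relElem k Γ c) = relEval k Γ d (fun a => β (arrowElem k Γ a)) c := by
  simp only [relElem, relEval, map_finsuppSum, map_smul, pathElem, pathProd, map_list_prod,
    List.map_map]
  rfl

variable {A : Type} [Ring A] [Algebra k A] {φ : PathAlgebra k Γ →ₐ[k] A}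

theorem pathRep_eq_zero (hφ : IsAdmissiblePresentation k Γ φ) (hM : M ∈ RepSet k Γ φ d)
    {x : PathAlgebra k Γ} (hx : φ x = 0) : pathRep hM.1 x = 0 := by
  obtain ⟨-, ⟨S, hS, hker⟩, -⟩ := hφ
  have hx' : x ∈ twoSidedSpan (PathAlgebra k Γ) S := by rw [hker]; exact hx
  unfold twoSidedSpan at hx'
  induction hx' using AddSubgroup.closure_induction with
  | mem y hy =>
    obtain ⟨a, b, s, hs, rfl⟩ := hy
    have hs0 : φ s = 0 := by
      have : s ∈ twoSidedSpan (PathAlgebra k Γ) S :=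
        AddSubgroup.subset_closure ⟨1, 1, s, hs, by simp⟩
      rwa [hker] at this
    obtain ⟨c, i, j, hc, rfl⟩ := hS s hs
    rw [map_mul, map_mul, map_relElem]
    simp only [pathRep_arrowElem]
    rw [hM.2 c i j hc hs0]
    simp
  | zero => simp
  | add y z hy hz h₁ h₂ =>
    have key : ∀ y ∈ (AddSubgroup.closure {x | ∃ a b : PathAlgebra k Γ, ∃ s ∈ S, x = a * s * b}),
      φ y = 0 := fun y hy => by
        have : y ∈ twoSidedSpan (PathAlgebra k Γ) S := hy
        rwa [hker] at this
    rw [map_add, h₁ (key y hy), h₂ (key z hz), add_zero]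
  | neg y hy h =>
    rw [map_neg, neg_eq_zero] at hx
    rw [map_neg, h hx, neg_zero]

/-- A point of the representation variety affords a representation of the algebra. -/
theorem exists_vrep_of_mem (hφ : IsAdmissiblePresentation k Γ φ) (hM : M ∈ RepSet k Γ φ d) :
    ∃ ρ : VRep k (fun i => φ (vertexElem k Γ i)) d, ∀ a, ρ.1 (φ (arrowElem k Γ a)) = M a := by
  have key : ∀ {x y}, φ x = φ y → pathRep hM.1 x = pathRep hM.1 y := fun {x y} h => by
    rw [← sub_eq_zero, ← map_sub]
    exact pathRep_eq_zero hφ hM (by rw [map_sub, h, sub_self])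
  have hs := Function.surjInv_eq hφ.1
  let ρ : A →ₐ[k] Matrix (VIx d) (VIx d) k :=
    { toFun := fun a => pathRep hM.1 (Function.surjInv hφ.1 a)
      map_one' := (key (by rw [hs, map_one])).trans (map_one (pathRep hM.1))
      map_mul' := fun a b => by
        rw [← map_mul]; exact key (by rw [hs, map_mul, hs, hs])
      map_zero' := (key (by rw [hs, map_zero])).trans (map_zero (pathRep hM.1))
      map_add' := fun a b => by
        rw [← map_add]; exact key (by rw [hs, map_add, hs, hs])
      commutes' := fun c => by
        rw [← AlgHom.commutes (pathRep hM.1)]; exact key (by rw [hs, AlgHom.commutes]) }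
  have hρ : ∀ x, ρ (φ x) = pathRep hM.1 x := fun x => key (hs _)
  refine ⟨⟨ρ, fun i => ?_⟩, fun a => ?_⟩
  · rw [hρ, pathRep_vertexElem]; rfl
  · exact (hρ _).trans (pathRep_arrowElem _ _)

theorem VRep.mem_repSet (ρ : VRep k (fun i => φ (vertexElem k Γ i)) d) :
    (fun a => ρ.1 (φ (arrowElem k Γ a))) ∈ RepSet k Γ φ d := by
  refine ⟨fun a u v h => ?_, fun c i j _ h0 => ?_⟩
  · constructor
    · by_contra hu
      refine h ?_
      change ρ.1 (φ (arrowElem k Γ a)) u v = 0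
      rw [← vertexElem_tgt_mul, map_mul, map_mul, ρ.2, Matrix.diagonal_mul, if_neg hu, zero_mul]
    · by_contra hu
      refine h ?_
      change ρ.1 (φ (arrowElem k Γ a)) u v = 0
      rw [← mul_vertexElem_src, map_mul, map_mul, ρ.2, Matrix.mul_diagonal, if_neg hu, mul_zero]
  · have := map_relElem (ρ.1.comp φ) c
    rw [AlgHom.comp_apply, h0, map_zero] at this
    exact this.symm

theorem exists_polynomial (hφ : Function.Surjective φ)
    {F : VRep k (fun i => φ (vertexElem k Γ i)) d → k} (hF : F ∈ regular k _ d) :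
    ∃ f : MvPolynomial (Γ.A × RepIx Γ d × RepIx Γ d) k, ∀ ρ, F ρ =
      MvPolynomial.eval (fun x => ρ.1 (φ (arrowElem k Γ x.1)) x.2.1 x.2.2) f := by
  induction hF using Algebra.adjoin_induction with
  | mem G hG =>
    obtain ⟨a, u, v, rfl⟩ := hG
    obtain ⟨x, rfl⟩ := hφ a
    suffices H : ∀ u v, ∃ f : MvPolynomial (Γ.A × RepIx Γ d × RepIx Γ d) k,
        ∀ ρ : VRep k (fun i => φ (vertexElem k Γ i)) d, ρ.1 (φ x) u v =
          MvPolynomial.eval (fun x => ρ.1 (φ (arrowElem k Γ x.1)) x.2.1 x.2.2) f from H u v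
    clear u v
    induction x using pathAlgebra_induction with
    | hv i =>
      intro u v
      refine ⟨MvPolynomial.C (blockIdem k d i u v), fun ρ => ?_⟩
      rw [MvPolynomial.eval_C, ρ.2 i]
      rfl
    | ha a => exact fun u v => ⟨MvPolynomial.X (a, u, v), fun ρ => by simp⟩
    | hc c =>
      exact fun u v => ⟨MvPolynomial.C (algebraMap k (Matrix (VIx d) (VIx d) k) c u v), fun ρ => by
        rw [MvPolynomial.eval_C, AlgHom.commutes, AlgHom.commutes]⟩
    | hadd x y hx hy =>
      intro u v
      obtain ⟨f, hf⟩ := hx u v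
      obtain ⟨g, hg⟩ := hy u v
      exact ⟨f + g, fun ρ => by rw [map_add, map_add, map_add, ← hf, ← hg]; rfl⟩
    | hmul x y hx hy =>
      intro u v
      choose f hf using hx
      choose g hg using hy
      refine ⟨∑ w, f u w * g w v, fun ρ => ?_⟩
      rw [map_mul, map_mul, map_sum, Matrix.mul_apply]
      exact Finset.sum_congr rfl fun w _ => by rw [map_mul, ← hf, ← hg]
  | algebraMap r => exact ⟨MvPolynomial.C r, fun ρ => by simp⟩
  | add F G _ _ hF hG =>
    obtain ⟨f, hf⟩ := hF
    obtain ⟨g, hg⟩ := hG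
    exact ⟨f + g, fun ρ => by rw [map_add, ← hf, ← hg]; rfl⟩
  | mul F G _ _ hF hG =>
    obtain ⟨f, hf⟩ := hF
    obtain ⟨g, hg⟩ := hG
    exact ⟨f * g, fun ρ => by rw [map_mul, ← hf, ← hg]; rfl⟩

theorem IsGeomIrreducible.repIrreducible (hφ : IsAdmissiblePresentation k Γ φ)
    (h : IsGeomIrreducible k Γ φ) : RepIrreducible k fun i => φ (vertexElem k Γ i) := by
  rintro d F₁ hF₁ F₂ hF₂ ⟨ρ₁, h₁⟩ ⟨ρ₂, h₂⟩
  obtain ⟨f₁, hf₁⟩ := exists_polynomial hφ.1 hF₁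
  obtain ⟨f₂, hf₂⟩ := exists_polynomial hφ.1 hF₂
  let U : MvPolynomial (Γ.A × RepIx Γ d × RepIx Γ d) k → Set (RepSpace k Γ d) := fun f =>
    {M | MvPolynomial.eval (fun x => M x.1 x.2.1 x.2.2) f ≠ 0}
  have hU : ∀ f, @IsOpen _ (repTopology k Γ d) (U f) := fun f =>
    ⟨{x | MvPolynomial.eval x f ≠ 0}, TopologicalSpace.GenerateOpen.basic _ ⟨f, rfl⟩, rfl⟩
  obtain ⟨M, hM, hM₁, hM₂⟩ := (h d).2 (U f₁) (U f₂) (hU f₁) (hU f₂)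
    ⟨_, ρ₁.mem_repSet, by rw [hf₁] at h₁; exact h₁⟩ ⟨_, ρ₂.mem_repSet, by rw [hf₂] at h₂; exact h₂⟩
  obtain ⟨ρ, hρ⟩ := exists_vrep_of_mem hφ hM
  refine ⟨ρ, ?_, ?_⟩
  · rw [hf₁]; simp only [hρ]; exact hM₁
  · rw [hf₂]; simp only [hρ]; exact hM₂

end

end

section

open Matrix

/-! ## The radical and the ordering of the vertices -/

section

variable {k : Type} [Field k] {Γ : FinQuiver} {A : Type} [Ring A] [Algebra k A]

/-- The span of the images of the products of at least `n` arrows. -/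
def arrowSpan (φ : PathAlgebra k Γ →ₐ[k] A) (n : ℕ) : Submodule k A :=
  Submodule.span k {x | ∃ l : List Γ.A, n ≤ l.length ∧ x = φ (l.map (arrowElem k Γ)).prod}

variable {φ : PathAlgebra k Γ →ₐ[k] A}

theorem prod_mem_arrowSpan {n : ℕ} (l : List Γ.A) (hl : n ≤ l.length) :
    φ (l.map (arrowElem k Γ)).prod ∈ arrowSpan φ n :=
  Submodule.subset_span ⟨l, hl, rfl⟩

theorem arrowSpan_mul_le (m n : ℕ) : arrowSpan φ m * arrowSpan φ n ≤ arrowSpan φ (m + n) := by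
  rw [arrowSpan, arrowSpan, Submodule.span_mul_span, Submodule.span_le]
  rintro _ ⟨_, ⟨l, hl, rfl⟩, _, ⟨l', hl', rfl⟩, rfl⟩
  change φ _ * φ _ ∈ _
  rw [← map_mul, ← List.prod_append, ← List.map_append]
  exact prod_mem_arrowSpan _ (by rw [List.length_append]; omega)

theorem arrowSpan_pow_le (n : ℕ) : arrowSpan φ 1 ^ n ≤ arrowSpan φ n := by
  induction n with
  | zero =>
    rw [pow_zero, Submodule.one_le]
    simpa using prod_mem_arrowSpan (φ := φ) [] le_rfl
  | succ n ih =>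
    rw [pow_succ]
    exact (mul_le_mul' ih le_rfl).trans (arrowSpan_mul_le n 1)

theorem arrowElem_mul_eq_zero {a b : Γ.A} (h : Γ.src a ≠ Γ.tgt b) :
    arrowElem k Γ a * arrowElem k Γ b = 0 := by
  rw [← mul_vertexElem_src, ← vertexElem_tgt_mul b, mul_assoc, ← mul_assoc (vertexElem k Γ _),
    completeOrthogonalIdempotents_vertexElem.ortho h, zero_mul, mul_zero]

theorem isChain_or_prod_eq_zero (l : List Γ.A) :
    l.IsChain (fun a b => Γ.src a = Γ.tgt b) ∨ (l.map (arrowElem k Γ)).prod = 0 := by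
  induction l with
  | nil => exact .inl .nil
  | cons a l ih =>
    rcases ih with h | h
    · cases l with
      | nil => exact .inl (.singleton a)
      | cons b l =>
        by_cases hab : Γ.src a = Γ.tgt b
        · exact .inl (.cons_cons hab h)
        · right
          rw [List.map_cons, List.map_cons, List.prod_cons, List.prod_cons, ← mul_assoc,
            arrowElem_mul_eq_zero hab, zero_mul]
    · right
      rw [List.map_cons, List.prod_cons, h, mul_zero]

theorem exists_arrowSpan_pow_eq_bot (hφ : IsAdmissiblePresentation k Γ φ) :
    ∃ m, arrowSpan φ 1 ^ m = ⊥ := by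
  obtain ⟨-, -, m, hm, h⟩ := hφ
  refine ⟨m, eq_bot_iff.2 ((arrowSpan_pow_le m).trans ?_)⟩
  rw [arrowSpan, Submodule.span_le]
  rintro _ ⟨l, hl, rfl⟩
  change φ _ = 0
  rcases isChain_or_prod_eq_zero (k := k) l with hc | h0
  · have hne : l ≠ [] := by
      rintro rfl
      simp at hl
      omega
    exact h ⟨l, hne, hc⟩ hl
  · rw [h0, map_zero]

theorem vertexElem_mul_prod (i : Γ.V) (a : Γ.A) (l : List Γ.A) :
    vertexElem k Γ i * ((a :: l).map (arrowElem k Γ)).prod =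
      if i = Γ.tgt a then ((a :: l).map (arrowElem k Γ)).prod else 0 := by
  rw [List.map_cons, List.prod_cons, ← mul_assoc, ← vertexElem_tgt_mul, ← mul_assoc]
  split_ifs with h
  · rw [h, vertexElem_mul_self]
  · rw [completeOrthogonalIdempotents_vertexElem.ortho h, zero_mul, zero_mul]

theorem prod_mul_vertexElem (i : Γ.V) (a : Γ.A) (l : List Γ.A) :
    ((l ++ [a]).map (arrowElem k Γ)).prod * vertexElem k Γ i =
      if Γ.src a = i then ((l ++ [a]).map (arrowElem k Γ)).prod else 0 := by
  rw [List.map_append, List.prod_append, List.map_singleton, List.prod_singleton,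
    ← mul_vertexElem_src, mul_assoc, mul_assoc]
  split_ifs with h
  · rw [h, vertexElem_mul_self]
  · rw [completeOrthogonalIdempotents_vertexElem.ortho h, mul_zero, mul_zero]

theorem mul_mem_arrowSpan (hφ : Function.Surjective φ) (a : A) :
    ∀ x ∈ arrowSpan φ 1, a * x ∈ arrowSpan φ 1 := by
  obtain ⟨y, rfl⟩ := hφ a
  induction y using pathAlgebra_induction with
  | hv i =>
    intro x hx
    induction hx using Submodule.span_induction with
    | mem x hx =>
      obtain ⟨l, hl, rfl⟩ := hx
      rw [← map_mul]
      cases l with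
      | nil => simp at hl
      | cons b l =>
        rw [vertexElem_mul_prod]
        split_ifs
        · exact prod_mem_arrowSpan _ hl
        · rw [map_zero]; exact Submodule.zero_mem _
    | zero => rw [mul_zero]; exact Submodule.zero_mem _
    | add x y _ _ hx hy => rw [mul_add]; exact Submodule.add_mem _ hx hy
    | smul c x _ hx => rw [mul_smul_comm]; exact Submodule.smul_mem _ _ hx
  | ha b =>
    intro x hx
    induction hx using Submodule.span_induction with
    | mem x hx =>
      obtain ⟨l, hl, rfl⟩ := hx
      rw [← map_mul, ← List.prod_cons, ← List.map_cons]
      exact prod_mem_arrowSpan _ (by simp)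
    | zero => rw [mul_zero]; exact Submodule.zero_mem _
    | add x y _ _ hx hy => rw [mul_add]; exact Submodule.add_mem _ hx hy
    | smul c x _ hx => rw [mul_smul_comm]; exact Submodule.smul_mem _ _ hx
  | hc c =>
    intro x hx
    rw [AlgHom.commutes, ← Algebra.smul_def]
    exact Submodule.smul_mem _ _ hx
  | hadd y z hy hz =>
    intro x hx
    rw [map_add, add_mul]
    exact Submodule.add_mem _ (hy x hx) (hz x hx)
  | hmul y z hy hz =>
    intro x hx
    rw [map_mul, mul_assoc]
    exact hy _ (hz x hx)

theorem mem_arrowSpan_mul (hφ : Function.Surjective φ) (a : A) :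
    ∀ x ∈ arrowSpan φ 1, x * a ∈ arrowSpan φ 1 := by
  obtain ⟨y, rfl⟩ := hφ a
  induction y using pathAlgebra_induction with
  | hv i =>
    intro x hx
    induction hx using Submodule.span_induction with
    | mem x hx =>
      obtain ⟨l, hl, rfl⟩ := hx
      rw [← map_mul]
      obtain rfl | ⟨l, b, rfl⟩ := l.eq_nil_or_concat
      · simp at hl
      · simp only [List.concat_eq_append] at hl ⊢
        rw [prod_mul_vertexElem]
        split_ifs
        · exact prod_mem_arrowSpan _ hl
        · rw [map_zero]; exact Submodule.zero_mem _
    | zero => rw [zero_mul]; exact Submodule.zero_mem _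
    | add x y _ _ hx hy => rw [add_mul]; exact Submodule.add_mem _ hx hy
    | smul c x _ hx => rw [smul_mul_assoc]; exact Submodule.smul_mem _ _ hx
  | ha b =>
    intro x hx
    induction hx using Submodule.span_induction with
    | mem x hx =>
      obtain ⟨l, hl, rfl⟩ := hx
      have : (l.map (arrowElem k Γ)).prod * arrowElem k Γ b =
          ((l ++ [b]).map (arrowElem k Γ)).prod := by simp
      rw [← map_mul, this]
      exact prod_mem_arrowSpan _ (by simp)
    | zero => rw [zero_mul]; exact Submodule.zero_mem _
    | add x y _ _ hx hy => rw [add_mul]; exact Submodule.add_mem _ hx hy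
    | smul c x _ hx => rw [smul_mul_assoc]; exact Submodule.smul_mem _ _ hx
  | hc c =>
    intro x hx
    rw [AlgHom.commutes, ← Algebra.commutes, ← Algebra.smul_def]
    exact Submodule.smul_mem _ _ hx
  | hadd y z hy hz =>
    intro x hx
    rw [map_add, mul_add]
    exact Submodule.add_mem _ (hy x hx) (hz x hx)
  | hmul y z hy hz =>
    intro x hx
    rw [map_mul, ← mul_assoc]
    exact hz _ (hy x hx)

theorem arrowElem_mem_arrowSpan (a : Γ.A) : φ (arrowElem k Γ a) ∈ arrowSpan φ 1 := by
  simpa using prod_mem_arrowSpan (φ := φ) [a] le_rfl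

theorem CompleteOrthogonalIdempotents.vertex (φ : PathAlgebra k Γ →ₐ[k] A) :
    CompleteOrthogonalIdempotents fun i => φ (vertexElem k Γ i) :=
  completeOrthogonalIdempotents_vertexElem.map φ.toRingHom

theorem exists_sub_mem_arrowSpan (hφ : Function.Surjective φ) (i : Γ.V) (a : A) :
    ∃ c : k, φ (vertexElem k Γ i) * a - c • φ (vertexElem k Γ i) ∈ arrowSpan φ 1 := by
  obtain ⟨y, rfl⟩ := hφ a
  induction y using pathAlgebra_induction with
  | hv j =>
    by_cases h : i = j
    · exact ⟨1, by rw [← map_mul, h, vertexElem_mul_self, one_smul, sub_self]; exact zero_mem _⟩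
    · refine ⟨0, ?_⟩
      rw [← map_mul, completeOrthogonalIdempotents_vertexElem.ortho h, map_zero, zero_smul,
        sub_self]
      exact zero_mem _
  | ha b =>
    exact ⟨0, by
      rw [zero_smul, sub_zero]; exact mul_mem_arrowSpan hφ _ _ (arrowElem_mem_arrowSpan b)⟩
  | hc c =>
    refine ⟨c, ?_⟩
    rw [AlgHom.commutes, ← Algebra.commutes, ← Algebra.smul_def, sub_self]
    exact zero_mem _
  | hadd y z hy hz =>
    obtain ⟨c, hc⟩ := hy
    obtain ⟨c', hc'⟩ := hz
    refine ⟨c + c', ?_⟩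
    rw [map_add, mul_add, add_smul, add_sub_add_comm]
    exact add_mem hc hc'
  | hmul y z hy hz =>
    obtain ⟨c, hc⟩ := hy
    obtain ⟨c', hc'⟩ := hz
    refine ⟨c * c', ?_⟩
    have h₁ := mem_arrowSpan_mul hφ (φ z) _ hc
    have h₂ := Submodule.smul_mem _ c hc'
    have := add_mem h₁ h₂
    rwa [sub_mul, smul_sub, smul_mul_assoc, smul_smul, sub_add_sub_cancel, mul_assoc,
      ← map_mul φ y z] at this

/-- The relation of being linked by an arrow-generated element acting nontrivially on some
one-dimensional-at-each-vertex representation. -/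
def Linked (φ : PathAlgebra k Γ →ₐ[k] A) (i j : Γ.V) : Prop :=
  ∃ w ∈ arrowSpan φ 1, φ (vertexElem k Γ j) * w = w ∧ w * φ (vertexElem k Γ i) = w ∧
    ∃ ρ : VRep k (fun i => φ (vertexElem k Γ i)) (fun _ => 1), ρ.1 w ⟨j, 0⟩ ⟨i, 0⟩ ≠ 0

theorem VRep.mul_apply_of_mul_eq {e : Γ.V → A} (ρ : VRep k e (fun _ => 1)) {i j l : Γ.V}
    (x : A) {y : A} (hy : e j * y = y) :
    ρ.1 (x * y) ⟨l, 0⟩ ⟨i, 0⟩ = ρ.1 x ⟨l, 0⟩ ⟨j, 0⟩ * ρ.1 y ⟨j, 0⟩ ⟨i, 0⟩ := by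
  rw [map_mul, Matrix.mul_apply, Fintype.sum_sigma, Finset.sum_eq_single j]
  · simp
  · intro m _ hm
    refine Finset.sum_eq_zero fun s _ => ?_
    rw [← hy, map_mul, ρ.2, Matrix.diagonal_mul, if_neg hm, zero_mul, mul_zero]
  · simp

theorem Linked.trans (h : RepIrreducible k fun i => φ (vertexElem k Γ i)) {i j l : Γ.V}
    (hij : Linked φ i j) (hjl : Linked φ j l) : Linked φ i l := by
  obtain ⟨w, hw, hjw, hwi, ρ, hρ⟩ := hij
  obtain ⟨w', hw', hlw, hwj, ρ', hρ'⟩ := hjl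
  obtain ⟨ρ, h₁, h₂⟩ := h _ _ (entry_mem_regular w ⟨j, 0⟩ ⟨i, 0⟩) _
    (entry_mem_regular w' ⟨l, 0⟩ ⟨j, 0⟩) ⟨ρ, hρ⟩ ⟨ρ', hρ'⟩
  refine ⟨w' * w, ?_, by rw [← mul_assoc, hlw], by rw [mul_assoc, hwi], ρ, ?_⟩
  · have := (arrowSpan_mul_le (φ := φ) 1 1) (Submodule.mul_mem_mul hw' hw)
    refine Submodule.span_mono ?_ this
    rintro _ ⟨l, hl, rfl⟩
    exact ⟨l, by omega, rfl⟩
  · rw [ρ.mul_apply_of_mul_eq w' hjw]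
    exact mul_ne_zero h₂ h₁

theorem Linked.irrefl (hφ : IsAdmissiblePresentation k Γ φ) (i : Γ.V) : ¬ Linked φ i i := by
  rintro ⟨w, hw, hiw, -, ρ, hρ⟩
  obtain ⟨m, hm⟩ := exists_arrowSpan_pow_eq_bot hφ
  have hpow : ∀ n, ρ.1 (w ^ (n + 1)) ⟨i, 0⟩ ⟨i, 0⟩ ≠ 0 := fun n => by
    induction n with
    | zero => simpa using hρ
    | succ n ih =>
      rw [pow_succ, ρ.mul_apply_of_mul_eq _ hiw]
      exact mul_ne_zero ih hρ
  have : w ^ m = 0 := by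
    have := Submodule.pow_mem_pow _ hw m
    rwa [hm, Submodule.mem_bot] at this
  refine hpow m ?_
  rw [pow_succ, this, zero_mul, map_zero]
  rfl

theorem Linked.of_arrow (hφ : IsAdmissiblePresentation k Γ φ) (a : Γ.A)
    (ha : Γ.src a ≠ Γ.tgt a) : Linked φ (Γ.src a) (Γ.tgt a) := by
  let M : RepSpace k Γ (fun _ => 1) :=
    Pi.single a (Matrix.single ⟨Γ.tgt a, 0⟩ ⟨Γ.src a, 0⟩ 1)
  have hmul : ∀ b c, M b * M c = 0 := fun b c => by
    by_cases hb : b = a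
    · by_cases hc : c = a
      · subst hb hc
        simp only [M, Pi.single_eq_same]
        apply Matrix.single_mul_single_of_ne
        exact fun h => ha (congrArg Sigma.fst h)
      · simp [M, Pi.single_eq_of_ne hc]
    · simp [M, Pi.single_eq_of_ne hb]
  have hM : M ∈ RepSet k Γ φ (fun _ => 1) := by
    refine ⟨fun b u v h => ?_, fun c i j hc _ => ?_⟩
    · by_cases hb : b = a
      · subst hb
        simp only [M, Pi.single_eq_same, Matrix.single_apply, ne_eq, ite_eq_right_iff,
          one_ne_zero, imp_false, not_not] at h
        exact ⟨by rw [← h.1], by rw [← h.2]⟩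
      · exact absurd (by simp [M, Pi.single_eq_of_ne hb]) h
    · refine Finset.sum_eq_zero fun p hp => ?_
      obtain ⟨hlen, -⟩ := hc p hp
      have : pathProd k Γ _ M p = 0 := by
        obtain ⟨l, hl, hch⟩ := p
        change 2 ≤ l.length at hlen
        change (l.map M).prod = 0
        match l, hlen with
        | b :: c :: l, _ =>
          rw [List.map_cons, List.map_cons, List.prod_cons, List.prod_cons, ← mul_assoc, hmul,
            zero_mul]
      change c p • pathProd k Γ _ M p = 0
      rw [this, smul_zero]
  obtain ⟨ρ, hρ⟩ := exists_vrep_of_mem hφ hM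
  refine ⟨φ (arrowElem k Γ a), arrowElem_mem_arrowSpan a, ?_, ?_, ρ, ?_⟩
  · rw [← map_mul, vertexElem_tgt_mul]
  · rw [← map_mul, mul_vertexElem_src]
  · rw [hρ]
    simp [M]

theorem Linked.of_mul_ne_zero (hφ : IsAdmissiblePresentation k Γ φ)
    (h : RepIrreducible k fun i => φ (vertexElem k Γ i)) (a : A) :
    ∀ i j, φ (vertexElem k Γ j) * a * φ (vertexElem k Γ i) ≠ 0 → i = j ∨ Linked φ i j := by
  have he := completeOrthogonalIdempotents_vertexElem (k := k) (Γ := Γ)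
  obtain ⟨y, rfl⟩ := hφ.1 a
  induction y using pathAlgebra_induction with
  | hv l =>
    intro i j h0
    left
    by_contra hij
    refine h0 ?_
    rw [← map_mul, ← map_mul]
    by_cases hl : j = l
    · rw [mul_assoc, ← hl, he.ortho (Ne.symm hij), mul_zero, map_zero]
    · rw [he.ortho hl, zero_mul, map_zero]
  | ha b =>
    intro i j h0
    rw [← map_mul, ← map_mul] at h0
    have hi : Γ.src b = i := by
      by_contra hi
      rw [← mul_vertexElem_src, mul_assoc, mul_assoc, he.ortho hi, mul_zero, mul_zero,
        map_zero] at h0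
      exact h0 rfl
    have hj : j = Γ.tgt b := by
      by_contra hj
      rw [← vertexElem_tgt_mul, ← mul_assoc, he.ortho hj, zero_mul, zero_mul, map_zero] at h0
      exact h0 rfl
    rw [← hi, hj]
    by_cases hb : Γ.src b = Γ.tgt b
    · exact .inl hb
    · exact .inr (.of_arrow hφ b hb)
  | hc c =>
    intro i j h0
    left
    by_contra hij
    refine h0 ?_
    rw [AlgHom.commutes, ← Algebra.commutes, mul_assoc, ← map_mul, he.ortho (Ne.symm hij),
      map_zero, mul_zero]
  | hadd y z hy hz =>
    intro i j h0
    rw [map_add, mul_add, add_mul] at h0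
    by_cases h1 : φ (vertexElem k Γ j) * φ y * φ (vertexElem k Γ i) = 0
    · rw [h1, zero_add] at h0
      exact hz i j h0
    · exact hy i j h1
  | hmul y z hy hz =>
    intro i j h0
    have : φ (vertexElem k Γ j) * φ (y * z) * φ (vertexElem k Γ i) =
        ∑ l, φ (vertexElem k Γ j) * φ y * φ (vertexElem k Γ l) *
          (φ (vertexElem k Γ l) * φ z * φ (vertexElem k Γ i)) := by
      have : ∀ l, φ (vertexElem k Γ j) * φ y * φ (vertexElem k Γ l) *
          (φ (vertexElem k Γ l) * φ z * φ (vertexElem k Γ i)) =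
          φ (vertexElem k Γ j) * φ y * φ (vertexElem k Γ l) *
            (φ z * φ (vertexElem k Γ i)) := fun l => by
        simp only [← map_mul, mul_assoc]
        rw [← mul_assoc (vertexElem k Γ l) (vertexElem k Γ l), vertexElem_mul_self]
      simp only [this]
      rw [← Finset.sum_mul, ← Finset.mul_sum, ← map_sum, he.complete, map_one, mul_one, map_mul]
      simp only [mul_assoc]
    rw [this] at h0
    obtain ⟨l, -, hl⟩ := Finset.exists_ne_zero_of_sum_ne_zero h0
    rcases hy l j (left_ne_zero_of_mul hl) with rfl | h₁
    · exact hz i l (right_ne_zero_of_mul hl)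
    · rcases hz i l (right_ne_zero_of_mul hl) with rfl | h₂
      · exact .inr h₁
      · exact .inr (h₂.trans h h₁)

theorem CornerClosed.vertex (hφ : IsAdmissiblePresentation k Γ φ)
    (h : RepIrreducible k fun i => φ (vertexElem k Γ i)) :
    CornerClosed fun i => φ (vertexElem k Γ i) := fun i j hij a b => by
  by_contra h0
  have hmul : φ (vertexElem k Γ i) * a * φ (vertexElem k Γ j) * b * φ (vertexElem k Γ i) =
      φ (vertexElem k Γ i) * a * φ (vertexElem k Γ j) *
        (φ (vertexElem k Γ j) * b * φ (vertexElem k Γ i)) := by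
    simp only [mul_assoc]
    rw [← mul_assoc (φ (vertexElem k Γ j)) (φ (vertexElem k Γ j)), ← map_mul,
      vertexElem_mul_self]
  simp only [hmul] at h0
  have h₁ := (Linked.of_mul_ne_zero hφ h a j i (left_ne_zero_of_mul h0)).resolve_left hij.symm
  have h₂ := (Linked.of_mul_ne_zero hφ h b i j (right_ne_zero_of_mul h0)).resolve_left hij
  exact Linked.irrefl hφ j (h₁.trans h h₂)

open Classical in
/-- The system of Frobenius corners of a geometrically irreducible algebra. -/
theorem IsGeomIrreducible.exists_frobSystem [Module.Finite k A]
    (hφ : IsAdmissiblePresentation k Γ φ) (hirr : IsGeomIrreducible k Γ φ) :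
    ∃ S : FrobSystem k A Γ.V, ∀ i, S.e i = φ (vertexElem k Γ i) := by
  have h := hirr.repIrreducible hφ
  have he := CompleteOrthogonalIdempotents.vertex φ
  have hc := CornerClosed.vertex hφ h
  refine ⟨{
    e := fun i => φ (vertexElem k Γ i)
    idem := he
    frob := fun i => (h.nonempty_frobCorner hc he i).some
    left := fun i => h.higman hc he _
    right := fun i => h.rightHigman hc he _
    h := fun j => (Finset.univ.filter fun i => Linked φ i j).card
    dir := fun i j hij hlt a => ?_
    J := arrowSpan φ 1
    mul_mem := mul_mem_arrowSpan hφ.1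
    mul_mem' := mem_arrowSpan_mul hφ.1
    nilp := exists_arrowSpan_pow_eq_bot hφ
    loc := fun i x hx => ?_ }, fun i => rfl⟩
  · by_contra h0
    have hl := (Linked.of_mul_ne_zero hφ h a i j h0).resolve_left hij
    refine hlt (Finset.card_lt_card ⟨fun l hl' => ?_, fun hle => ?_⟩)
    · simp only [Finset.mem_filter, Finset.mem_univ, true_and] at hl' ⊢
      exact hl'.trans h hl
    · have := hle (Finset.mem_filter.2 ⟨Finset.mem_univ i, hl⟩)
      exact Linked.irrefl hφ i (Finset.mem_filter.1 this).2
  · obtain ⟨c, hc⟩ := exists_sub_mem_arrowSpan hφ.1 i x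
    exact ⟨c, by rwa [hx.1] at hc⟩

end

end

/-- Let `A = KQ/I` be a geometrically irreducible finite-dimensional
algebra over an algebraically closed field `K` (with `I` admissible).  Then `A` is an
Iwanaga–Gorenstein algebra: the left `A`-module `A` has finite injective dimension and
the right `A`-module `A` (i.e. the left `Aᵐᵒᵖ`-module `Aᵐᵒᵖ`) has finite injective
dimension.  Moreover, for a finite-dimensional `A`-module `M` the following are
equivalent: (i) `M` has finite projective dimension; (ii) `M` has finite injective
dimension; (iii) `M` is locally free. -/
theorem iwanagaGorenstein_of_geomIrreducible [IsAlgClosed K]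
    (A : Type) [Ring A] [Algebra K A] [Module.Finite K A]
    (φ : PathAlgebra K Q →ₐ[K] A) (hadm : IsAdmissiblePresentation K Q φ)
    (hirr : IsGeomIrreducible K Q φ) :
    (∃ n : ℕ, HasInjDimLE A n (ModuleCat.of A A)) ∧
    (∃ n : ℕ, HasInjDimLE Aᵐᵒᵖ n (ModuleCat.of Aᵐᵒᵖ Aᵐᵒᵖ)) ∧
    ∀ (M : Type) [AddCommGroup M] [Module K M] [Module A M] [IsScalarTower K A M]
      [Module.Finite K M],
      ((∃ n : ℕ, HasProjDimLE A n (ModuleCat.of A M)) ↔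
        (∃ n : ℕ, HasInjDimLE A n (ModuleCat.of A M))) ∧
      ((∃ n : ℕ, HasProjDimLE A n (ModuleCat.of A M)) ↔ IsLocallyFree K Q φ M) := by
  obtain ⟨S, hS⟩ := hirr.exists_frobSystem hadm
  refine ⟨S.exists_hasInjDimLE_self, S.exists_hasInjDimLE_op_self, fun M _ _ _ _ _ => ⟨?_, ?_⟩⟩
  · exact (S.exists_hasProjDimLE_iff M).trans (S.exists_hasInjDimLE_iff M).symm
  · exact (S.exists_hasProjDimLE_iff M).trans (forall_congr' fun i =>
      S.higman_iff_free M i (vertexIdem K Q φ i) (hS i).symm)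
end
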